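/- Let k be a field, R = k[s,u,t,v] with the bigrading deg s = deg u = (1,0), deg t = deg v = (0,1), and let f1, f2, f3 ∈ R be bihomogeneous of bidegrees (d1,d1'), (d2,d2'), (d3,d3') generating an ideal I of height 2 such that no minimal prime over I contains the irrelevant ideal b = ⟨st, sv, ut, uv⟩. Then K_{k,k'} = V_{k,k'} for every pair (k,k') with (k − d1 − d2 − d3 + 1)·(k' − d1' − d2' − d3' + 1) ≥ 0 if and only if I is a local complete intersection, i.e., for every minimal prime P over I the extended ideal I·R_P is generated by an R_P-regular sequence of length two. -/

import Mathlib

/-!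
STATEMENT 14: k field, R = k[s,u,t,v] bigraded; f1,f2,f3 bihomogeneous of
bidegrees (d_i,d_i') generating an ideal I of height 2 such that no minimal
prime over I contains the irrelevant ideal b.  Then K_{k,k'} = V_{k,k'} for
every (k,k') with (k − d1 − d2 − d3 + 1)(k' − d1' − d2' − d3' + 1) ≥ 0
iff I is a local complete intersection.

Variables: X 0 = s, X 1 = u, X 2 = t, X 3 = v.
-/

open MvPolynomial

noncomputable section

/-- bidegree weights: s,u ↦ (1,0); t,v ↦ (0,1). -/
def bw : Fin 4 → ℤ × ℤ := ![(1,0), (1,0), (0,1), (0,1)]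

/-- `p` is bihomogeneous of bidegree `(a,b)`. -/
def Bihom {k : Type} [Field k] (p : MvPolynomial (Fin 4) k) (a b : ℤ) : Prop :=
  p.IsWeightedHomogeneous bw (a, b)

/-- The irrelevant ideal ⟨st, sv, ut, uv⟩. -/
def irrel (k : Type) [Field k] : Ideal (MvPolynomial (Fin 4) k) :=
  Ideal.span {X 0 * X 2, X 0 * X 3, X 1 * X 2, X 1 * X 3}

/-- Height of an ideal: infimum of the heights of the primes containing it. -/
def idealHeight {A : Type*} [CommRing A] (I : Ideal A) : ℕ∞ :=
  ⨅ (P : PrimeSpectrum A) (_ : I ≤ P.asIdeal), Order.height P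

/-- Saturation of an ideal `I` with respect to the ideal `b`. -/
def Ideal.sat {A : Type*} [CommRing A] (b I : Ideal A) : Set A :=
  { x | ∃ j : ℕ, ∀ y ∈ b ^ j, y * x ∈ I }

/-- The Koszul module of f₁, f₂, f₃. -/
def Kos {k : Type} [Field k] (f₁ f₂ f₃ : MvPolynomial (Fin 4) k) :
    Submodule (MvPolynomial (Fin 4) k) (Fin 3 → MvPolynomial (Fin 4) k) :=
  Submodule.span (MvPolynomial (Fin 4) k) {![f₂, -f₁, 0], ![f₃, 0, -f₁], ![0, f₃, -f₂]}

/-- `x, y` has only the trivial syzygies. -/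
def SReg {A : Type*} [CommRing A] (x y : A) : Prop :=
  ∀ a b : A, a * x + b * y = 0 → ∃ h, a = h * y ∧ b = -(h * x)

/-- `g` is a Koszul syzygy. -/
def KosEq {A : Type*} [CommRing A] (f₀ f₁ f₂ g₀ g₁ g₂ : A) : Prop :=
  ∃ c₀ c₁ c₂ : A, g₀ = c₀ * f₁ + c₁ * f₂ ∧ g₁ = -(c₀ * f₀) + c₂ * f₂ ∧
    g₂ = -(c₁ * f₀) - c₂ * f₁

section LocalAlg

variable {A : Type*} [CommRing A]

lemma SReg.symm {x y : A} (h : SReg x y) : SReg y x := by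
  intro a b hab
  obtain ⟨c, h1, h2⟩ := h b a (by linear_combination hab)
  exact ⟨-c, by linear_combination h2, by linear_combination h1⟩

lemma SReg.ne_zero [Nontrivial A] {x y : A} (h : SReg x y) (hy : ¬ IsUnit y) : x ≠ 0 := by
  rintro rfl
  obtain ⟨c, h1, _⟩ := h 1 0 (by simp)
  exact hy (IsUnit.of_mul_eq_one c (by rw [mul_comm]; exact h1.symm))

lemma SReg.of_mem [IsDomain A] [IsLocalRing A] {g₁ g₂ x y : A} (h : SReg g₁ g₂)
    (hg2 : ¬ IsUnit g₂) (hy : ¬ IsUnit y)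
    (h1 : g₁ ∈ Ideal.span {x, y}) (h2 : g₂ ∈ Ideal.span {x, y}) : SReg x y := by
  have g1 := h.ne_zero hg2
  obtain ⟨p, q, hp⟩ := Ideal.mem_span_pair.1 h1
  obtain ⟨r, t, hr⟩ := Ideal.mem_span_pair.1 h2
  have hx : x ≠ 0 := by
    rintro rfl
    obtain ⟨c, h3, h4⟩ := h t (-q) (by rw [← hp, ← hr]; ring)
    apply hy
    have : g₁ * (1 - c * y) = 0 := by linear_combination (-1 : A) * hp - y * h4
    rcases mul_eq_zero.1 this with h5 | h5
    · exact absurd h5 g1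
    · exact IsUnit.of_mul_eq_one c (by linear_combination -h5)
  intro a b hab
  obtain ⟨c, h3, h4⟩ := h (r * b - t * a) (-(p * b - q * a)) (by
    apply mul_left_cancel₀ hx
    have e1 : b * g₁ = (p * b - q * a) * x := by rw [← hp]; linear_combination q * hab
    have e2 : b * g₂ = (r * b - t * a) * x := by rw [← hr]; linear_combination t * hab
    linear_combination (-g₁) * e2 + g₂ * e1)
  have e1 : b * g₁ = (p * b - q * a) * x := by rw [← hp]; linear_combination q * hab
  have hb : b = c * x := by
    apply mul_right_cancel₀ g1
    linear_combination e1 - x * h4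
  refine ⟨-c, ?_, by linear_combination hb⟩
  apply mul_right_cancel₀ hx
  linear_combination hab - y * hb

open scoped Pointwise in
lemma sreg_iff_isRegular [IsDomain A] [IsLocalRing A] {x y : A} :
    RingTheory.Sequence.IsRegular A [x, y] ↔
      (SReg x y ∧ ¬ IsUnit x ∧ ¬ IsUnit y) := by
  have key : RingTheory.Sequence.IsWeaklyRegular A [x, y] ↔
      (IsSMulRegular A x ∧ ∀ b, y * b ∈ Ideal.span {x} → b ∈ Ideal.span {x}) := by
    rw [RingTheory.Sequence.isWeaklyRegular_cons_iff,
      RingTheory.Sequence.isWeaklyRegular_singleton_iff]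
    have : (x • (⊤ : Submodule A A)) = Ideal.span {x} := by
      rw [← Submodule.ideal_span_singleton_smul]; simp
    unfold QuotSMulTop
    rw [this, isSMulRegular_quotient_iff_mem_of_smul_mem]
    rfl
  have e0 : Ideal.ofList [x, y] • (⊤ : Submodule A A) = Ideal.span {x, y} := by
    rw [Ideal.ofList_cons, Ideal.ofList_singleton, Ideal.span_insert]; simp
  rw [RingTheory.Sequence.isRegular_iff, key, e0]
  have e1 : (⊤ : Submodule A A) ≠ Ideal.span {x, y} ↔ (¬ IsUnit x ∧ ¬ IsUnit y) := by
    constructor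
    · intro h
      constructor
      · intro hx
        exact h (Ideal.eq_top_of_isUnit_mem _ (Ideal.subset_span (by simp)) hx).symm
      · intro hx
        exact h (Ideal.eq_top_of_isUnit_mem _ (Ideal.subset_span (by simp)) hx).symm
    · rintro ⟨h1, h2⟩ h
      have : Ideal.span {x, y} ≤ IsLocalRing.maximalIdeal A := by
        rw [Ideal.span_le]
        rintro z (rfl | rfl)
        · exact h1
        · exact h2
      rw [← h] at this
      exact (IsLocalRing.maximalIdeal.isMaximal A).ne_top (top_le_iff.1 this)
  rw [e1]
  constructor
  · rintro ⟨⟨h1, h2⟩, h3, h4⟩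
    refine ⟨?_, h3, h4⟩
    have hx : x ≠ 0 := by
      rintro rfl
      have := @h1 1 0 (by simp)
      exact one_ne_zero this
    intro a b hab
    obtain ⟨c, hc⟩ := Ideal.mem_span_singleton'.1 (h2 b
      (Ideal.mem_span_singleton'.2 ⟨-a, by linear_combination -hab⟩))
    refine ⟨-c, ?_, by linear_combination -hc⟩
    apply mul_right_cancel₀ hx
    linear_combination hab + y * hc
  · rintro ⟨h, h3, h4⟩
    refine ⟨⟨?_, ?_⟩, h3, h4⟩
    · have hx := h.ne_zero h4
      intro a b hab
      exact mul_left_cancel₀ hx hab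
    · intro b hb
      obtain ⟨c, hc⟩ := Ideal.mem_span_singleton'.1 hb
      obtain ⟨e, _, he⟩ := h (-c) b (by linear_combination -hc)
      exact Ideal.mem_span_singleton'.2 ⟨-e, by linear_combination -he⟩

lemma socle_form [IsDomain A] {x y g₁ g₂ a₁ b₁ a₂ b₂ c : A} (hxy : SReg x y) (hg : SReg g₁ g₂)
    (hx : x ≠ 0)
    (h1 : g₁ = a₁ * x + b₁ * y) (h2 : g₂ = a₂ * x + b₂ * y)
    (hcx : c * x ∈ Ideal.span {g₁, g₂}) (hcy : c * y ∈ Ideal.span {g₁, g₂}) :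
    ∃ h, c - h * (a₁ * b₂ - a₂ * b₁) ∈ Ideal.span {g₁, g₂} := by
  obtain ⟨α, β, hα⟩ := Ideal.mem_span_pair.1 hcx
  obtain ⟨γ, δ, hγ⟩ := Ideal.mem_span_pair.1 hcy
  obtain ⟨h, k1, k2⟩ := hg (y * α - x * γ) (y * β - x * δ) (by
    linear_combination y * hα - x * hγ)
  obtain ⟨e, l1, l2⟩ := hxy (-(γ + h * a₂)) (α - h * b₂) (by
    linear_combination k1 + h * h2)
  obtain ⟨e', m1, m2⟩ := hxy (-(δ - h * a₁)) (β + h * b₁) (by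
    linear_combination k2 - h * h1)
  refine ⟨h, Ideal.mem_span_pair.2 ⟨-e, -e', ?_⟩⟩
  apply mul_right_cancel₀ hx
  linear_combination hα - g₁ * l2 - g₂ * m2 - h * b₂ * h1 + h * b₁ * h2

lemma exists_socle_mem [IsLocalRing A] {J L : Ideal A} (N : ℕ)
    (hN : IsLocalRing.maximalIdeal A ^ N ≤ J) (hL : ¬ L ≤ J) :
    ∃ c ∈ L, c ∉ J ∧ ∀ z ∈ IsLocalRing.maximalIdeal A, c * z ∈ J := by
  classical
  have hex : ∃ n, IsLocalRing.maximalIdeal A ^ n * L ≤ J :=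
    ⟨N, Ideal.mul_le_left.trans hN⟩
  have hn := Nat.find_spec hex
  have hn0 : Nat.find hex ≠ 0 := by
    intro h
    rw [h] at hn
    exact hL (by simpa using hn)
  obtain ⟨m, hm⟩ := Nat.exists_eq_succ_of_ne_zero hn0
  have hmin := Nat.find_min hex (m := m) (by omega)
  obtain ⟨c, hc, hcJ⟩ := Set.not_subset.1 hmin
  refine ⟨c, Ideal.mul_le_right hc, hcJ, fun z hz => ?_⟩
  rw [hm, pow_succ', mul_assoc] at hn
  rw [mul_comm]
  exact hn (Ideal.mul_mem_mul hz hc)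

lemma delta_mem [IsDomain A] [IsLocalRing A] {x y g₁ g₂ a₁ b₁ a₂ b₂ : A}
    (hxy : SReg x y) (hg : SReg g₁ g₂)
    (hx : x ≠ 0) (hm : IsLocalRing.maximalIdeal A = Ideal.span {x, y})
    (h1 : g₁ = a₁ * x + b₁ * y) (h2 : g₂ = a₂ * x + b₂ * y) (N : ℕ)
    (hN : IsLocalRing.maximalIdeal A ^ N ≤ Ideal.span {g₁, g₂}) {L : Ideal A}
    (hJL : Ideal.span {g₁, g₂} ≤ L) (hL : ¬ L ≤ Ideal.span {g₁, g₂}) :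
    a₁ * b₂ - a₂ * b₁ ∈ L ∧ a₁ * b₂ - a₂ * b₁ ∉ Ideal.span {g₁, g₂} := by
  obtain ⟨c, hcL, hcJ, hc⟩ := exists_socle_mem N hN hL
  have hxm : x ∈ IsLocalRing.maximalIdeal A := by rw [hm]; exact Ideal.subset_span (by simp)
  have hym : y ∈ IsLocalRing.maximalIdeal A := by rw [hm]; exact Ideal.subset_span (by simp)
  obtain ⟨h, hh⟩ := socle_form hxy hg hx h1 h2 (hc x hxm) (hc y hym)
  have hD : a₁ * b₂ - a₂ * b₁ ∉ Ideal.span {g₁, g₂} := fun hD =>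
    hcJ (by simpa using add_mem hh (Ideal.mul_mem_left _ h hD))
  refine ⟨?_, hD⟩
  have hu : IsUnit h := by
    by_contra hu
    have : h ∈ Ideal.span {x, y} := by rw [← hm]; exact hu
    obtain ⟨p, q, hpq⟩ := Ideal.mem_span_pair.1 this
    apply hcJ
    have : h * (a₁ * b₂ - a₂ * b₁) ∈ Ideal.span {g₁, g₂} := by
      rw [← hpq]
      refine Ideal.mem_span_pair.2 ⟨p * b₂ - q * a₂, q * a₁ - p * b₁, ?_⟩
      rw [h1, h2]; ring
    simpa using add_mem hh this
  have h3 : h * (a₁ * b₂ - a₂ * b₁) ∈ L := by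
    have := sub_mem hcL (hJL hh)
    simpa using this
  exact (Ideal.unit_mul_mem_iff_mem L hu).1 h3

lemma length_arg [IsNoetherianRing A] [IsLocalRing A] {J : Ideal A} [IsArtinianRing (A ⧸ J)]
    (S : Submodule A (A × A)) (g : A)
    (hS1 : ∀ c, g * c ∈ J → ∃ a, (a, c) ∈ S)
    (hS2 : ∀ a c, (a, c) ∈ S → a ∈ J ⊔ Ideal.span {g} → c ∈ J) :
    ∃ a c, (a, c) ∈ S ∧ 1 - a ∈ J ⊔ Ideal.span {g} := by
  have : IsArtinian A (A ⧸ J) :=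
    isArtinian_of_surjective_algebraMap (Ideal.Quotient.mk_surjective (I := J))
  let μ : (A ⧸ J) →ₗ[A] (A ⧸ J) := LinearMap.lsmul A (A ⧸ J) g
  have hμ : ∀ a : A, (Submodule.Quotient.mk a : A ⧸ J) ∈ LinearMap.range μ ↔
      a ∈ J ⊔ Ideal.span {g} := by
    intro a
    constructor
    · rintro ⟨b, hb⟩
      obtain ⟨b, rfl⟩ := Submodule.Quotient.mk_surjective J b
      have : b * g - a ∈ J := by
        rw [← Submodule.Quotient.eq J, ← hb, mul_comm]; rfl
      rw [← sub_sub_cancel (b * g) a]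
      exact sub_mem (Ideal.mem_sup_right (Ideal.mem_span_singleton'.2 ⟨b, rfl⟩))
        (Ideal.mem_sup_left this)
    · intro h
      obtain ⟨j, hj, z, hz, rfl⟩ := Submodule.mem_sup.1 h
      obtain ⟨b, rfl⟩ := Ideal.mem_span_singleton'.1 hz
      refine ⟨Submodule.Quotient.mk b, ?_⟩
      change Submodule.Quotient.mk (g * b) = _
      rw [Submodule.Quotient.eq]
      have : g * b - (j + b * g) = -j := by ring
      rw [this]; exact neg_mem hj
  let ψ : S →ₗ[A] ((A ⧸ J) ⧸ LinearMap.range μ) :=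
    (LinearMap.range μ).mkQ ∘ₗ J.mkQ ∘ₗ LinearMap.fst A A A ∘ₗ S.subtype
  let χ : S →ₗ[A] (A ⧸ J) := J.mkQ ∘ₗ LinearMap.snd A A A ∘ₗ S.subtype
  have hψ : ∀ s : S, ψ s = 0 ↔ s.1.1 ∈ J ⊔ Ideal.span {g} := by
    intro s
    rw [← hμ]
    exact Submodule.Quotient.mk_eq_zero _
  have hker : LinearMap.ker ψ ≤ LinearMap.ker χ := by
    rintro ⟨⟨a, c⟩, hs⟩ h
    rw [LinearMap.mem_ker, hψ] at h
    exact (Submodule.Quotient.mk_eq_zero _).2 (hS2 a c hs h)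
  have hχ : LinearMap.ker μ ≤ LinearMap.range χ := by
    intro c hc
    obtain ⟨c, rfl⟩ := Submodule.Quotient.mk_surjective J c
    have hc' : (Submodule.Quotient.mk (g * c) : A ⧸ J) = 0 := hc
    rw [Submodule.Quotient.mk_eq_zero] at hc'
    obtain ⟨a, ha⟩ := hS1 c hc'
    exact ⟨⟨(a, c), ha⟩, rfl⟩
  have l1 : Module.length A (LinearMap.range χ) ≤ Module.length A (LinearMap.range ψ) := by
    rw [← (LinearMap.quotKerEquivRange χ).length_eq, ← (LinearMap.quotKerEquivRange ψ).length_eq]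
    exact Module.length_le_of_surjective (Submodule.factor hker) (Submodule.factor_surjective hker)
  have l2 : Module.length A (LinearMap.ker μ) ≤ Module.length A (LinearMap.range χ) :=
    Module.length_le_of_injective (Submodule.inclusion hχ) (Submodule.inclusion_injective hχ)
  have l3 := Module.length_eq_add_of_exact (LinearMap.ker μ).subtype μ.rangeRestrict
    (Submodule.subtype_injective _) μ.surjective_rangeRestrict (by
      rw [LinearMap.exact_iff]; simp)
  have l4 := Module.length_eq_add_of_exact (LinearMap.range μ).subtype (LinearMap.range μ).mkQ
    (Submodule.subtype_injective _) (Submodule.mkQ_surjective _) (by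
      rw [LinearMap.exact_iff]; simp)
  have l5 : Module.length A (LinearMap.range μ) ≠ ⊤ := Module.length_ne_top
  have l6 : Module.length A (LinearMap.ker μ) =
      Module.length A ((A ⧸ J) ⧸ LinearMap.range μ) := by
    rw [l3, add_comm] at l4
    exact ((ENat.add_right_injective_of_ne_top l5) l4)
  have htop : LinearMap.range ψ = ⊤ := by
    by_contra h
    have := Submodule.length_lt h
    exact absurd (l6 ▸ (l2.trans l1)) (not_le.2 this)
  obtain ⟨⟨⟨a, c⟩, hs⟩, h⟩ := LinearMap.range_eq_top.1 htop
    (Submodule.Quotient.mk (Submodule.Quotient.mk 1))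
  refine ⟨a, c, hs, ?_⟩
  rw [← hμ]
  have h' : (Submodule.Quotient.mk (Submodule.Quotient.mk a) : (A ⧸ J) ⧸ LinearMap.range μ) =
    Submodule.Quotient.mk (Submodule.Quotient.mk 1) := h
  rw [eq_comm, Submodule.Quotient.eq] at h'
  exact h'

end LocalAlg

section LocalAlg2

variable {A : Type*} [CommRing A]

lemma KosEq.perm₁ {f₀ f₁ f₂ g₀ g₁ g₂ : A} (h : KosEq f₀ f₂ f₁ g₀ g₂ g₁) :
    KosEq f₀ f₁ f₂ g₀ g₁ g₂ := by
  obtain ⟨c₀, c₁, c₂, h0, h1, h2⟩ := h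
  exact ⟨c₁, c₀, -c₂, by linear_combination h0, by linear_combination h2,
    by linear_combination h1⟩

lemma KosEq.perm₂ {f₀ f₁ f₂ g₀ g₁ g₂ : A} (h : KosEq f₁ f₂ f₀ g₁ g₂ g₀) :
    KosEq f₀ f₁ f₂ g₀ g₁ g₂ := by
  obtain ⟨c₀, c₁, c₂, h0, h1, h2⟩ := h
  exact ⟨-c₁, -c₂, c₀, by linear_combination h2, by linear_combination h0,
    by linear_combination h1⟩

lemma kosEq_of_sreg {f₀ f₁ f₂ g₀ g₁ g₂ : A} (hr : SReg f₀ f₁)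
    (hg : g₂ ∈ Ideal.span {f₀, f₁}) (h : g₀ * f₀ + g₁ * f₁ + g₂ * f₂ = 0) :
    KosEq f₀ f₁ f₂ g₀ g₁ g₂ := by
  obtain ⟨α, β, hα⟩ := Ideal.mem_span_pair.1 hg
  obtain ⟨c, h1, h2⟩ := hr (g₀ + α * f₂) (g₁ + β * f₂) (by linear_combination h + f₂ * hα)
  exact ⟨c, -α, -β, by linear_combination h1, by linear_combination h2,
    by linear_combination -hα⟩

lemma SReg.of_minor [IsDomain A] [IsLocalRing A] {x y f₀ f₁ a₀ b₀ a₁ b₁ : A} (h : SReg x y)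
    (hx : ¬ IsUnit x) (hy : ¬ IsUnit y)
    (h0 : f₀ = a₀ * x + b₀ * y) (h1 : f₁ = a₁ * x + b₁ * y)
    (hu : IsUnit (a₀ * b₁ - a₁ * b₀)) :
    SReg f₀ f₁ ∧ Ideal.span {x, y} ≤ Ideal.span {f₀, f₁} := by
  obtain ⟨u, hu⟩ := hu.exists_right_inv
  have e1 : x ∈ Ideal.span {f₀, f₁} := Ideal.mem_span_pair.2 ⟨u * b₁, -(u * b₀), by
    rw [h0, h1]; linear_combination x * hu⟩
  have e2 : y ∈ Ideal.span {f₀, f₁} := Ideal.mem_span_pair.2 ⟨-(u * a₁), u * a₀, by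
    rw [h0, h1]; linear_combination y * hu⟩
  refine ⟨h.of_mem hy ?_ e1 e2, ?_⟩
  · intro hf
    have : f₁ ∈ IsLocalRing.maximalIdeal A := by
      rw [h1]
      exact add_mem (Ideal.mul_mem_left _ _ hx) (Ideal.mul_mem_left _ _ hy)
    exact this hf
  · rw [Ideal.span_le]
    rintro z (rfl | rfl)
    · exact e1
    · exact e2

lemma local_bwd [IsDomain A] [IsLocalRing A] {x y f₀ f₁ f₂ g₀ g₁ g₂ : A} (h : SReg x y)
    (hx : ¬ IsUnit x) (hy : ¬ IsUnit y)
    (hI : Ideal.span {f₀, f₁, f₂} = Ideal.span {x, y})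
    (hg0 : g₀ ∈ Ideal.span {x, y}) (hg1 : g₁ ∈ Ideal.span {x, y})
    (hg2 : g₂ ∈ Ideal.span {x, y})
    (hs : g₀ * f₀ + g₁ * f₁ + g₂ * f₂ = 0) : KosEq f₀ f₁ f₂ g₀ g₁ g₂ := by
  have m0 : f₀ ∈ Ideal.span {x, y} := hI ▸ Ideal.subset_span (by simp)
  have m1 : f₁ ∈ Ideal.span {x, y} := hI ▸ Ideal.subset_span (by simp)
  have m2 : f₂ ∈ Ideal.span {x, y} := hI ▸ Ideal.subset_span (by simp)
  have mx : x ∈ Ideal.span {f₀, f₁, f₂} := hI ▸ Ideal.subset_span (by simp)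
  have my : y ∈ Ideal.span {f₀, f₁, f₂} := hI ▸ Ideal.subset_span (by simp)
  obtain ⟨a₀, b₀, h0⟩ := Ideal.mem_span_pair.1 m0
  obtain ⟨a₁, b₁, h1⟩ := Ideal.mem_span_pair.1 m1
  obtain ⟨a₂, b₂, h2⟩ := Ideal.mem_span_pair.1 m2
  obtain ⟨p₀, p₁, p₂, hp⟩ := Submodule.mem_span_triple.1 mx
  obtain ⟨q₀, q₁, q₂, hq⟩ := Submodule.mem_span_triple.1 my
  simp only [smul_eq_mul] at hp hq
  by_cases u01 : IsUnit (a₀ * b₁ - a₁ * b₀)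
  · obtain ⟨r, hr⟩ := h.of_minor hx hy h0.symm h1.symm u01
    exact kosEq_of_sreg r (hr hg2) hs
  by_cases u02 : IsUnit (a₀ * b₂ - a₂ * b₀)
  · obtain ⟨r, hr⟩ := h.of_minor hx hy h0.symm h2.symm u02
    exact (kosEq_of_sreg r (hr hg1) (by linear_combination hs)).perm₁
  by_cases u12 : IsUnit (a₁ * b₂ - a₂ * b₁)
  · obtain ⟨r, hr⟩ := h.of_minor hx hy h1.symm h2.symm u12
    exact (kosEq_of_sreg r (hr hg0) (by linear_combination hs)).perm₂
  exfalso
  obtain ⟨c, hc1, hc2⟩ := h (1 - (p₀ * a₀ + p₁ * a₁ + p₂ * a₂))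
    (-(p₀ * b₀ + p₁ * b₁ + p₂ * b₂)) (by
      linear_combination -hp - p₀ * h0 - p₁ * h1 - p₂ * h2)
  obtain ⟨e, he1, he2⟩ := h (-(q₀ * a₀ + q₁ * a₁ + q₂ * a₂))
    (1 - (q₀ * b₀ + q₁ * b₁ + q₂ * b₂)) (by
      linear_combination -hq - q₀ * h0 - q₁ * h1 - q₂ * h2)
  have key : (1 : A) ∈ IsLocalRing.maximalIdeal A := by
    have : (1 : A) = (p₀ * q₁ - p₁ * q₀) * (a₀ * b₁ - a₁ * b₀) +
        (p₀ * q₂ - p₂ * q₀) * (a₀ * b₂ - a₂ * b₀) +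
        (p₁ * q₂ - p₂ * q₁) * (a₁ * b₂ - a₂ * b₁) + c * y
        - e * x * (p₀ * a₀ + p₁ * a₁ + p₂ * a₂) +
        (q₀ * a₀ + q₁ * a₁ + q₂ * a₂) * (c * x) := by
      linear_combination hc1 + (p₀ * a₀ + p₁ * a₁ + p₂ * a₂) * he2
        - (q₀ * a₀ + q₁ * a₁ + q₂ * a₂) * hc2
    rw [this]
    refine add_mem (sub_mem (add_mem (add_mem (add_mem ?_ ?_) ?_) ?_) ?_) ?_
    · exact Ideal.mul_mem_left _ _ u01
    · exact Ideal.mul_mem_left _ _ u02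
    · exact Ideal.mul_mem_left _ _ u12
    · exact Ideal.mul_mem_left _ _ hy
    · exact Ideal.mul_mem_right _ _ (Ideal.mul_mem_left _ _ hx)
    · exact Ideal.mul_mem_left _ _ (Ideal.mul_mem_left _ _ hx)
  exact key isUnit_one

lemma fwd_alt [IsDomain A] [IsNoetherianRing A] [IsLocalRing A] {g₁ g₂ g₃ D : A}
    [IsArtinianRing (A ⧸ Ideal.span {g₁, g₂})] (hg : SReg g₁ g₂)
    (hD : ∀ L : Ideal A, Ideal.span {g₁, g₂} ≤ L → ¬ L ≤ Ideal.span {g₁, g₂} → D ∈ L) :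
    (∃ a b c, a * g₁ + b * g₂ + c * g₃ = 0 ∧ 1 - a ∈ Ideal.span {g₁, g₂} ⊔ Ideal.span {g₃}) ∨
    (∃ a b, a * g₁ + b * g₂ + D * g₃ = 0 ∧ a ∈ Ideal.span {g₁, g₂} ⊔ Ideal.span {g₃}) := by
  set J := Ideal.span {g₁, g₂} with hJ
  set I := J ⊔ Ideal.span {g₃} with hI
  have hg3 : g₃ ∈ I := Ideal.mem_sup_right (Ideal.mem_span_singleton_self _)
  let S : Submodule A (A × A) :=
    { carrier := {p | ∃ b, p.1 * g₁ + b * g₂ + p.2 * g₃ = 0}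
      add_mem' := by
        rintro ⟨a, c⟩ ⟨a', c'⟩ ⟨b, hb⟩ ⟨b', hb'⟩
        refine ⟨b + b', ?_⟩
        simp only [Prod.mk_add_mk] at *
        linear_combination hb + hb'
      zero_mem' := ⟨0, by simp⟩
      smul_mem' := by
        rintro r ⟨a, c⟩ ⟨b, hb⟩
        refine ⟨r * b, ?_⟩
        simp only [Prod.smul_mk, smul_eq_mul] at *
        linear_combination r * hb }
  let L : Ideal A :=
    { carrier := {c | ∃ a b, a * g₁ + b * g₂ + c * g₃ = 0 ∧ a ∈ I}
      add_mem' := by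
        rintro c c' ⟨a, b, h, ha⟩ ⟨a', b', h', ha'⟩
        exact ⟨a + a', b + b', by linear_combination h + h', add_mem ha ha'⟩
      zero_mem' := ⟨0, 0, by simp, zero_mem _⟩
      smul_mem' := by
        rintro r c ⟨a, b, h, ha⟩
        refine ⟨r * a, r * b, ?_, Ideal.mul_mem_left _ _ ha⟩
        simp only [smul_eq_mul]
        linear_combination r * h }
  by_cases hL : L ≤ J
  · left
    obtain ⟨a, c, ⟨b, hb⟩, h⟩ := length_arg (J := J) S g₃ (by
      intro c hc
      obtain ⟨p, q, hpq⟩ := Ideal.mem_span_pair.1 hc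
      exact ⟨-p, -q, by linear_combination -hpq⟩) (by
      rintro a c ⟨b, hb⟩ ha
      exact hL ⟨a, b, hb, ha⟩)
    exact ⟨a, b, c, hb, h⟩
  · right
    refine hD L ?_ hL
    intro c hc
    obtain ⟨p, q, hpq⟩ := Ideal.mem_span_pair.1 hc
    exact ⟨-(p * g₃), -(q * g₃), by linear_combination -g₃ * hpq,
      neg_mem (Ideal.mul_mem_left _ _ hg3)⟩

lemma fwd_unit [IsDomain A] [IsLocalRing A] {g₁ g₂ g₃ a b c : A} (hg : SReg g₁ g₂)
    (h2 : ¬ IsUnit g₂) (h3 : ¬ IsUnit g₃)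
    (hle : Ideal.span {g₁, g₂} ⊔ Ideal.span {g₃} ≤ IsLocalRing.maximalIdeal A)
    (h : a * g₁ + b * g₂ + c * g₃ = 0)
    (ha : 1 - a ∈ Ideal.span {g₁, g₂} ⊔ Ideal.span {g₃}) :
    Ideal.span {g₁, g₂} ⊔ Ideal.span {g₃} = Ideal.span {g₂, g₃} ∧ SReg g₂ g₃ := by
  have hu : IsUnit a := by
    by_contra hu
    have := add_mem (hle ha) (show a ∈ IsLocalRing.maximalIdeal A from hu)
    simp at this
  obtain ⟨u, hu⟩ := hu.exists_right_inv
  have m1 : g₁ ∈ Ideal.span {g₂, g₃} := Ideal.mem_span_pair.2 ⟨-(u * b), -(u * c), by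
    linear_combination g₁ * hu - u * h⟩
  have m2 : g₂ ∈ Ideal.span {g₂, g₃} := Ideal.subset_span (by simp)
  have m3 : g₃ ∈ Ideal.span {g₂, g₃} := Ideal.subset_span (by simp)
  refine ⟨le_antisymm ?_ ?_, hg.of_mem h2 h3 m1 m2⟩
  · refine sup_le ?_ ?_ <;> rw [Ideal.span_le]
    · rintro z (rfl | rfl)
      · exact m1
      · exact m2
    · rintro z rfl
      exact m3
  · rw [Ideal.span_le]
    rintro z (rfl | rfl)
    · exact Ideal.mem_sup_left (Ideal.subset_span (by simp))
    · exact Ideal.mem_sup_right (Ideal.mem_span_singleton_self _)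

lemma local_fwd [IsDomain A] [IsNoetherianRing A] [IsLocalRing A] {x y g₁ g₂ g₃ : A}
    (hm : IsLocalRing.maximalIdeal A = Ideal.span {x, y})
    (h1 : ¬ IsUnit g₁) (h2 : ¬ IsUnit g₂) (h3 : ¬ IsUnit g₃) (hg : SReg g₁ g₂)
    (hmin : IsLocalRing.maximalIdeal A ∈ (Ideal.span {g₁, g₂}).minimalPrimes)
    (hK : ∀ a b c, a ∈ Ideal.span {g₁, g₂} ⊔ Ideal.span {g₃} →
      b ∈ Ideal.span {g₁, g₂} ⊔ Ideal.span {g₃} → c ∈ Ideal.span {g₁, g₂} ⊔ Ideal.span {g₃} →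
      a * g₁ + b * g₂ + c * g₃ = 0 → c ∈ Ideal.span {g₁, g₂}) :
    ∃ z w, Ideal.span {g₁, g₂} ⊔ Ideal.span {g₃} = Ideal.span {z, w} ∧
      SReg z w ∧ ¬ IsUnit z ∧ ¬ IsUnit w := by
  have hart := IsLocalRing.quotient_artinian_of_mem_minimalPrimes_of_isLocalRing _ hmin
  obtain ⟨N, hN⟩ := IsLocalRing.exists_maximalIdeal_pow_le_of_isArtinianRing_quotient
    (Ideal.span {g₁, g₂})
  by_cases h3J : g₃ ∈ Ideal.span {g₁, g₂}
  · refine ⟨g₁, g₂, ?_, hg, h1, h2⟩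
    rw [sup_eq_left, Ideal.span_le]
    rintro z rfl
    exact h3J
  have m1 : g₁ ∈ Ideal.span {x, y} := hm ▸ h1
  have m2 : g₂ ∈ Ideal.span {x, y} := hm ▸ h2
  have hy : ¬ IsUnit y := by
    have : y ∈ IsLocalRing.maximalIdeal A := hm ▸ Ideal.subset_span (by simp)
    exact this
  have hxy : SReg x y := hg.of_mem h2 hy m1 m2
  have hx : x ≠ 0 := hxy.ne_zero hy
  have hle : Ideal.span {g₁, g₂} ⊔ Ideal.span {g₃} ≤ IsLocalRing.maximalIdeal A := by
    refine sup_le ?_ ?_ <;> rw [Ideal.span_le]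
    · rintro z (rfl | rfl)
      · exact h1
      · exact h2
    · rintro z rfl
      exact h3
  obtain ⟨a₁, b₁, e1⟩ := Ideal.mem_span_pair.1 m1
  obtain ⟨a₂, b₂, e2⟩ := Ideal.mem_span_pair.1 m2
  have hD := fun (L : Ideal A) (hJL : Ideal.span {g₁, g₂} ≤ L) hL =>
    delta_mem hxy hg hx hm e1.symm e2.symm N hN hJL hL
  set D := a₁ * b₂ - a₂ * b₁
  obtain ⟨hDI, hDJ⟩ := hD _ (le_sup_left (b := Ideal.span {g₃})) (fun h =>
    h3J (h (Ideal.mem_sup_right (Ideal.mem_span_singleton_self _))))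
  have hsw : Ideal.span {g₁, g₂} = Ideal.span {g₂, g₁} := by rw [Set.pair_comm]
  rcases fwd_alt (g₃ := g₃) (D := D) hg (fun L a b => (hD L a b).1) with
    ⟨a, b, c, h, ha⟩ | ⟨a, b, h, ha⟩
  · obtain ⟨e, r⟩ := fwd_unit hg h2 h3 hle h ha
    exact ⟨g₂, g₃, e, r, h2, h3⟩
  have hart' : IsArtinianRing (A ⧸ Ideal.span {g₂, g₁}) := by rw [← hsw]; exact hart
  rcases fwd_alt (g₃ := g₃) (D := D) hg.symm (fun L a b =>
    (hD L (by rw [hsw]; exact a) (by rw [hsw]; exact b)).1) with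
    ⟨b', a', c, h', ha'⟩ | ⟨b', a', h', hb'⟩
  · obtain ⟨e, r⟩ := fwd_unit hg.symm h1 h3 (by rw [← hsw]; exact hle) h' ha'
    exact ⟨g₁, g₃, by rw [hsw]; exact e, r, h1, h3⟩
  exfalso
  rw [← hsw] at hb'
  obtain ⟨t, t1, t2⟩ := hg (a - a') (b - b') (by linear_combination h - h')
  have hb : b ∈ Ideal.span {g₁, g₂} ⊔ Ideal.span {g₃} := by
    have : b = b' - t * g₁ := by linear_combination t2
    rw [this]
    exact sub_mem hb' (Ideal.mul_mem_left _ _ (Ideal.mem_sup_left (Ideal.subset_span (by simp))))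
  exact hDJ (hK a b D ha hb hDI h)

end LocalAlg2

section Homog

variable {k : Type} [Field k]

/-- The Koszul differential. -/
def dK {A : Type*} [CommRing A] (f : Fin 3 → A) : (Fin 3 → A) →ₗ[A] (Fin 3 → A) where
  toFun c := ![c 0 * f 1 + c 1 * f 2, -(c 0 * f 0) + c 2 * f 2, -(c 1 * f 0) - c 2 * f 1]
  map_add' c c' := by
    ext i; fin_cases i <;> simp <;> ring
  map_smul' r c := by
    ext i; fin_cases i <;> simp <;> ring

/-- The generator of the kernel of the Koszul differential. -/
def vF {A : Type*} [CommRing A] (f : Fin 3 → A) : Fin 3 → A := ![f 2, -f 1, f 0]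

lemma dK_vF {A : Type*} [CommRing A] (f : Fin 3 → A) : dK f (vF f) = 0 := by
  ext i; fin_cases i <;> simp [dK, vF] <;> ring

lemma kosEq_iff {A : Type*} [CommRing A] (f g : Fin 3 → A) :
    KosEq (f 0) (f 1) (f 2) (g 0) (g 1) (g 2) ↔ ∃ c, g = dK f c := by
  constructor
  · rintro ⟨c₀, c₁, c₂, h0, h1, h2⟩
    refine ⟨![c₀, c₁, c₂], ?_⟩
    ext i; fin_cases i <;> simp [dK, *]
  · rintro ⟨c, rfl⟩
    exact ⟨c 0, c 1, c 2, by simp [dK], by simp [dK], by simp [dK]⟩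

lemma mem_Kos_iff (f g : Fin 3 → MvPolynomial (Fin 4) k) :
    g ∈ Kos (f 0) (f 1) (f 2) ↔ ∃ c, g = dK f c := by
  unfold Kos
  rw [Submodule.mem_span_triple]
  constructor
  · rintro ⟨a, b, c, rfl⟩
    refine ⟨![a, b, c], ?_⟩
    ext i; fin_cases i <;> simp [dK] <;> ring
  · rintro ⟨c, rfl⟩
    refine ⟨c 0, c 1, c 2, ?_⟩
    ext i; fin_cases i <;> simp [dK]; ring

lemma comp_mul {σ M : Type*} [AddCommGroup M] (w : σ → M) {f : MvPolynomial σ k} {e : M}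
    (hf : IsWeightedHomogeneous w f e) (m : M) (p : MvPolynomial σ k) :
    weightedHomogeneousComponent w m (p * f) = weightedHomogeneousComponent w (m - e) p * f := by
  classical
  ext d
  rw [coeff_weightedHomogeneousComponent, coeff_mul, coeff_mul]
  have : ∀ x ∈ Finset.HasAntidiagonal.antidiagonal d, coeff x.1 (weightedHomogeneousComponent w (m - e) p) *
      coeff x.2 f = if Finsupp.weight w d = m then coeff x.1 p * coeff x.2 f else 0 := by
    rintro ⟨x, y⟩ hxy
    rw [Finset.HasAntidiagonal.mem_antidiagonal] at hxy
    simp only at hxy ⊢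
    rw [coeff_weightedHomogeneousComponent]
    by_cases hy : coeff y f = 0
    · simp [hy]
    · have hy' := hf hy
      have : Finsupp.weight w x = m - e ↔ Finsupp.weight w d = m := by
        rw [← hxy, map_add, hy', eq_sub_iff_add_eq]
      by_cases h : Finsupp.weight w d = m
      · rw [if_pos (this.2 h), if_pos h]
      · rw [if_neg (fun h' => h (this.1 h')), if_neg h, zero_mul]
  rw [Finset.sum_congr rfl this]
  split_ifs <;> simp

lemma comp_hom {σ M : Type*} [AddCommMonoid M] (w : σ → M) (m : M) (p : MvPolynomial σ k) :
    IsWeightedHomogeneous w (weightedHomogeneousComponent w m p) m :=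
  weightedHomogeneousComponent_isWeightedHomogeneous m p

lemma hom_congr {σ M : Type*} [AddCommMonoid M] {w : σ → M} {p : MvPolynomial σ k} {e e' : M}
    (h : IsWeightedHomogeneous w p e) (he : e = e') : IsWeightedHomogeneous w p e' := he ▸ h

/-- Degrees of the second Koszul term. -/
def dd {M : Type*} [AddCommGroup M] (d : Fin 3 → M) : Fin 3 → M :=
  ![d 0 + d 1, d 0 + d 2, d 1 + d 2]

lemma dK_comp {σ M : Type*} [AddCommGroup M] (w : σ → M) {f : Fin 3 → MvPolynomial σ k}
    {d : Fin 3 → M} (hf : ∀ i, IsWeightedHomogeneous w (f i) (d i)) (m : M)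
    {g c : Fin 3 → MvPolynomial σ k} (h : g = dK f c) :
    (fun i => weightedHomogeneousComponent w (m - d i) (g i)) =
      dK f (fun i => weightedHomogeneousComponent w (m - dd d i) (c i)) := by
  subst h
  have e1 : m - d 0 - d 1 = m - (d 0 + d 1) := by abel
  have e2 : m - d 0 - d 2 = m - (d 0 + d 2) := by abel
  have e3 : m - d 1 - d 0 = m - (d 0 + d 1) := by abel
  have e4 : m - d 1 - d 2 = m - (d 1 + d 2) := by abel
  have e5 : m - d 2 - d 0 = m - (d 0 + d 2) := by abel
  have e6 : m - d 2 - d 1 = m - (d 1 + d 2) := by abel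
  ext1 i
  fin_cases i <;> simp [dK, dd, comp_mul w (hf _), e1, e2, e3, e4, e5, e6]

lemma dK_hom {σ M : Type*} [AddCommGroup M] (w : σ → M) {f : Fin 3 → MvPolynomial σ k}
    {d : Fin 3 → M} (hf : ∀ i, IsWeightedHomogeneous w (f i) (d i)) (m : M)
    {g c : Fin 3 → MvPolynomial σ k} (h : g = dK f c)
    (hg : ∀ i, IsWeightedHomogeneous w (g i) (m - d i)) :
    ∃ c', g = dK f c' ∧ ∀ i, IsWeightedHomogeneous w (c' i) (m - dd d i) := by
  refine ⟨_, ?_, fun i => comp_hom w _ (c i)⟩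
  rw [← dK_comp w hf m h]
  ext1 i
  exact ((hg i).weightedHomogeneousComponent_same).symm

lemma exists_vF {A : Type*} [CommRing A] [IsDomain A] [UniqueFactorizationMonoid A]
    {f : Fin 3 → A} (hp : ∀ p, Prime p → ∃ i, ¬ p ∣ f i) (hne : ∃ i, f i ≠ 0) {c : Fin 3 → A}
    (h : dK f c = 0) : ∃ τ : A, c = τ • vF f := by
  have hdiv : ∀ x y : A, x ≠ 0 → (∀ i, x ∣ f i * y) → x ∣ y := by
    intro x
    induction x using UniqueFactorizationMonoid.induction_on_prime with
    | h₁ => intro y h; exact absurd rfl h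
    | h₂ x hx => intro y _ _; exact hx.dvd
    | h₃ a p ha hpp ih =>
      intro y _ hy
      obtain ⟨i, hi⟩ := hp p hpp
      have : p ∣ y := (hpp.dvd_or_dvd ((Dvd.intro _ rfl).trans (hy i))).resolve_left hi
      obtain ⟨z, rfl⟩ := this
      refine mul_dvd_mul_left p (ih z ha fun j => ?_)
      have := hy j
      rw [mul_left_comm] at this
      exact (mul_dvd_mul_iff_left hpp.ne_zero).1 this
  have h0 : c 0 * f 1 + c 1 * f 2 = 0 := congrFun h 0
  have h1 : -(c 0 * f 0) + c 2 * f 2 = 0 := congrFun h 1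
  have h2 : -(c 1 * f 0) - c 2 * f 1 = 0 := congrFun h 2
  obtain ⟨i, hi⟩ := hne
  fin_cases i
  · obtain ⟨τ, hτ⟩ := hdiv (f 0) (c 2) hi (by
      intro j; fin_cases j
      · exact ⟨c 2, by simp⟩
      · exact ⟨-c 1, by simp; linear_combination -h2⟩
      · exact ⟨c 0, by simp; linear_combination h1⟩)
    refine ⟨τ, ?_⟩
    ext j; fin_cases j <;> apply mul_left_cancel₀ (show f 0 ≠ 0 from hi) <;> simp [vF, -mul_eq_mul_left_iff]
    · linear_combination -h1 + f 2 * hτ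
    · linear_combination -h2 - f 1 * hτ
    · linear_combination f 0 * hτ
  · obtain ⟨τ, hτ⟩ := hdiv (f 1) (-c 1) hi (by
      intro j; fin_cases j
      · exact ⟨c 2, by simp; linear_combination h2⟩
      · exact ⟨-c 1, by simp⟩
      · exact ⟨c 0, by simp; linear_combination -h0⟩)
    refine ⟨τ, ?_⟩
    ext j; fin_cases j <;> apply mul_left_cancel₀ (show f 1 ≠ 0 from hi) <;> simp [vF, -mul_eq_mul_left_iff]
    · linear_combination h0 + f 2 * hτ
    · linear_combination -f 1 * hτ
    · linear_combination -h2 + f 0 * hτ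
  · obtain ⟨τ, hτ⟩ := hdiv (f 2) (c 0) hi (by
      intro j; fin_cases j
      · exact ⟨c 2, by simp; linear_combination -h1⟩
      · exact ⟨-c 1, by simp; linear_combination h0⟩
      · exact ⟨c 0, by simp⟩)
    refine ⟨τ, ?_⟩
    ext j; fin_cases j <;> apply mul_left_cancel₀ (show f 2 ≠ 0 from hi) <;> simp [vF, -mul_eq_mul_left_iff]
    · linear_combination f 2 * hτ
    · linear_combination h0 - f 1 * hτ
    · linear_combination h1 + f 0 * hτ

lemma exists_vF_hom {σ M : Type*} [AddCommGroup M] (w : σ → M)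
    {f : Fin 3 → MvPolynomial σ k}
    {d : Fin 3 → M} (hf : ∀ i, IsWeightedHomogeneous w (f i) (d i))
    (hp : ∀ p, Prime p → ∃ i, ¬ p ∣ f i) (hne : ∃ i, f i ≠ 0) {m : M}
    {c : Fin 3 → MvPolynomial σ k}
    (hc : ∀ i, IsWeightedHomogeneous w (c i) (m - dd d i))
    (h : dK f c = 0) : ∃ τ : MvPolynomial σ k, c = τ • vF f ∧
      IsWeightedHomogeneous w τ (m - d 0 - d 1 - d 2) := by
  obtain ⟨τ, hτ⟩ := exists_vF hp hne h
  refine ⟨weightedHomogeneousComponent w (m - d 0 - d 1 - d 2) τ, ?_, comp_hom _ _ _⟩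
  have e0 : c 0 = τ * f 2 := by rw [hτ]; simp [vF]
  have e1 : c 1 = -(τ * f 1) := by rw [hτ]; simp [vF]
  have e2 : c 2 = τ * f 0 := by rw [hτ]; simp [vF]
  have k0 : m - dd d 0 - d 2 = m - d 0 - d 1 - d 2 := by simp [dd]; abel
  have k1 : m - dd d 1 - d 1 = m - d 0 - d 1 - d 2 := by simp [dd]; abel
  have k2 : m - dd d 2 - d 0 = m - d 0 - d 1 - d 2 := by simp [dd]; abel
  ext1 i
  rw [← (hc i).weightedHomogeneousComponent_same]
  fin_cases i
  · simp [e0, vF, comp_mul w (hf 2), k0]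
  · simp [e1, vF, comp_mul w (hf 1), k1]
  · simp [e2, vF, comp_mul w (hf 0), k2]

lemma descend {A : Type*} [CommRing A] [IsDomain A] {f : Fin 3 → A} {x y τ : A}
    {h c₁ c₂ : Fin 3 → A}
    (hx : x ≠ 0) (hxy : ∀ a b, y * a = x * b → ∃ e, a = x * e)
    (h1 : x • h = dK f c₁)
    (hτ : y • c₁ - x • c₂ = τ • vF f) (hm : τ ∈ Ideal.span {x, y}) :
    ∃ e, h = dK f e := by
  obtain ⟨q, p, hpq⟩ := Ideal.mem_span_pair.1 hm
  have key : ∀ i, ∃ e, (c₁ - p • vF f) i = x * e := by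
    intro i
    apply hxy _ ((c₂ + q • vF f) i)
    have := congrFun hτ i
    simp at this ⊢
    linear_combination this - vF f i * hpq
  choose e he using key
  refine ⟨e, ?_⟩
  have h2 : c₁ - p • vF f = x • e := by ext1 i; simpa using he i
  have h3 : x • h = x • dK f e := by
    rw [← map_smul, ← h2, map_sub, map_smul, dK_vF, h1]; simp
  ext1 i
  exact mul_left_cancel₀ hx (congrFun h3 i)

lemma weight_bw (m : Fin 4 →₀ ℕ) :
    Finsupp.weight bw m = (((m 0 + m 1 : ℕ) : ℤ), ((m 2 + m 3 : ℕ) : ℤ)) := by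
  rw [Finsupp.weight_apply, Finsupp.sum_fintype _ _ (by simp), Fin.sum_univ_four]
  simp [bw]

lemma mem_span_X_pow (i j : Fin 4) (n : ℕ) (p : MvPolynomial (Fin 4) k) :
    p ∈ Ideal.span {X i ^ n, X j ^ n} ↔ ∀ m ∈ p.support, n ≤ m i ∨ n ≤ m j := by
  have : ({X i ^ n, X j ^ n} : Set (MvPolynomial (Fin 4) k)) =
      (fun s => monomial s (1 : k)) '' {Finsupp.single i n, Finsupp.single j n} := by
    rw [Set.image_pair]; simp [X_pow_eq_monomial]
  rw [this, mem_ideal_span_monomial_image]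
  simp

lemma X_pow_coprime {i j : Fin 4} (hij : i ≠ j) (n : ℕ) (a b : MvPolynomial (Fin 4) k)
    (h : X j ^ n * a = X i ^ n * b) : ∃ e, a = X i ^ n * e := by
  have hpr : Prime (X i : MvPolynomial (Fin 4) k) := X_prime
  have hd : X i ^ n ∣ X j ^ n * a := ⟨b, h⟩
  refine hpr.pow_dvd_of_dvd_mul_left n (fun h' => ?_) hd
  have := hpr.dvd_of_dvd_pow h'
  rw [X_dvd_X] at this
  exact hij this

lemma sat_to_kos {f : Fin 3 → MvPolynomial (Fin 4) k} {d : Fin 3 → ℤ × ℤ}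
    (hf : ∀ i, IsWeightedHomogeneous bw (f i) (d i))
    (hp : ∀ p, Prime p → ∃ i, ¬ p ∣ f i) (hne : ∃ i, f i ≠ 0)
    {g : Fin 3 → MvPolynomial (Fin 4) k} {m : ℤ × ℤ}
    (hg : ∀ i, IsWeightedHomogeneous bw (g i) (m - d i))
    (hm : ((m - d 0 - d 1 - d 2).1 + 1) * ((m - d 0 - d 1 - d 2).2 + 1) ≥ 0)
    (n : ℕ)
    (hn : ∀ i ∈ ({0, 1} : Set (Fin 4)), ∀ j ∈ ({2, 3} : Set (Fin 4)),
      ∃ c, (X i ^ n * X j ^ n : MvPolynomial (Fin 4) k) • g = dK f c) : ∃ c, g = dK f c := by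
  have hXd : ∀ i : Fin 4, IsWeightedHomogeneous bw (X i ^ n : MvPolynomial (Fin 4) k)
      (n • bw i) := fun i => (isWeightedHomogeneous_X k bw i).pow n
  have hX0 : ∀ i : Fin 4, (X i ^ n : MvPolynomial (Fin 4) k) ≠ 0 := fun i =>
    pow_ne_zero _ (X_ne_zero i)
  -- homogeneous choice
  have hn' : ∀ i ∈ ({0, 1} : Set (Fin 4)), ∀ j ∈ ({2, 3} : Set (Fin 4)),
      ∃ c, (X i ^ n * X j ^ n : MvPolynomial (Fin 4) k) • g = dK f c ∧
        ∀ l, IsWeightedHomogeneous bw (c l) (n • bw i + n • bw j + m - dd d l) := by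
    intro i hi j hj
    obtain ⟨c, hc⟩ := hn i hi j hj
    refine dK_hom bw hf _ hc (fun l => ?_)
    have := ((hXd i).mul (hXd j)).mul (hg l)
    rwa [← add_sub_assoc] at this
  have b0 : bw 0 = (1, 0) := rfl
  have b1 : bw 1 = (1, 0) := rfl
  have b2 : bw 2 = (0, 1) := rfl
  have b3 : bw 3 = (0, 1) := rfl
  -- relations in the `s,u` direction
  have step1 : ∀ j ∈ ({2, 3} : Set (Fin 4)), ∀ c0 c1 : Fin 3 → MvPolynomial (Fin 4) k,
      (X 0 ^ n * X j ^ n : MvPolynomial (Fin 4) k) • g = dK f c0 →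
      (X 1 ^ n * X j ^ n : MvPolynomial (Fin 4) k) • g = dK f c1 →
      (∀ l, IsWeightedHomogeneous bw (c0 l) (n • bw 0 + n • bw j + m - dd d l)) →
      (∀ l, IsWeightedHomogeneous bw (c1 l) (n • bw 1 + n • bw j + m - dd d l)) →
      ∃ τ : MvPolynomial (Fin 4) k, (X 1 ^ n : MvPolynomial (Fin 4) k) • c0 - (X 0 ^ n : MvPolynomial (Fin 4) k) • c1
          = τ • vF f ∧
        IsWeightedHomogeneous bw τ ((2 * (n : ℤ), (0 : ℤ)) + n • bw j + m - d 0 - d 1 - d 2) := by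
    intro j hj c0 c1 h0 h1 hc0 hc1
    refine exists_vF_hom bw hf hp hne (fun l => ?_) ?_
    · refine IsWeightedHomogeneous.sub ?_ ?_
      · have := (hXd 1).mul (hc0 l)
        refine hom_congr this ?_
        rw [b0, b1]; ext <;> simp <;> ring
      · have := (hXd 0).mul (hc1 l)
        refine hom_congr this ?_
        rw [b0, b1]; ext <;> simp <;> ring
    · rw [map_sub, map_smul, map_smul, ← h0, ← h1, smul_smul, smul_smul, ← sub_smul]
      ring_nf; simp
  obtain ⟨c02, h02, d02⟩ := hn' 0 (by simp) 2 (by simp)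
  obtain ⟨c12, h12, d12⟩ := hn' 1 (by simp) 2 (by simp)
  obtain ⟨c03, h03, d03⟩ := hn' 0 (by simp) 3 (by simp)
  obtain ⟨c13, h13, d13⟩ := hn' 1 (by simp) 3 (by simp)
  obtain ⟨τ2, t2, hτ2⟩ := step1 2 (by simp) c02 c12 h02 h12 d02 d12
  obtain ⟨τ3, t3, hτ3⟩ := step1 3 (by simp) c03 c13 h03 h13 d03 d13
  obtain ⟨σ0, s0⟩ := exists_vF hp hne (c := (X 3 ^ n : MvPolynomial (Fin 4) k) • c02 -
      (X 2 ^ n : MvPolynomial (Fin 4) k) • c03) (by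
    rw [map_sub, map_smul, map_smul, ← h02, ← h03, smul_smul, smul_smul, ← sub_smul]
    ring_nf; simp)
  obtain ⟨σ1, s1⟩ := exists_vF hp hne (c := (X 3 ^ n : MvPolynomial (Fin 4) k) • c12 -
      (X 2 ^ n : MvPolynomial (Fin 4) k) • c13) (by
    rw [map_sub, map_smul, map_smul, ← h12, ← h13, smul_smul, smul_smul, ← sub_smul]
    ring_nf; simp)
  obtain ⟨i0, hi0⟩ : ∃ i, vF f i ≠ 0 := by
    obtain ⟨i, hi⟩ := hne
    fin_cases i
    · exact ⟨2, hi⟩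
    · exact ⟨1, neg_ne_zero.2 hi⟩
    · exact ⟨0, hi⟩
  have hrel : X 3 ^ n * τ2 - X 2 ^ n * τ3 = X 1 ^ n * σ0 - X 0 ^ n * σ1 := by
    apply mul_right_cancel₀ hi0
    have a1 := congrFun t2 i0
    have a2 := congrFun t3 i0
    have a3 := congrFun s0 i0
    have a4 := congrFun s1 i0
    simp only [Pi.sub_apply, Pi.smul_apply, smul_eq_mul] at a1 a2 a3 a4
    linear_combination (-X 3 ^ n) * a1 + X 2 ^ n * a2 + X 1 ^ n * a3 - X 0 ^ n * a4
  set α := (m - d 0 - d 1 - d 2).1 with hα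
  set β := (m - d 0 - d 1 - d 2).2 with hβ
  have wt2 : ∀ τ : MvPolynomial (Fin 4) k, ∀ j ∈ ({2, 3} : Set (Fin 4)),
      IsWeightedHomogeneous bw τ ((2 * (n : ℤ), (0 : ℤ)) + n • bw j + m - d 0 - d 1 - d 2) →
      ∀ μ ∈ τ.support, (μ 0 : ℤ) + μ 1 = 2 * n + α ∧ (μ 2 : ℤ) + μ 3 = n + β := by
    intro τ j hj hτ μ hμ
    have h1 := hτ (mem_support_iff.1 hμ)
    rw [weight_bw] at h1
    have hb : bw j = (0, 1) := by rcases hj with rfl | rfl <;> rfl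
    rw [hb] at h1
    have e1 := congrArg Prod.fst h1
    have e2 := congrArg Prod.snd h1
    simp at e1 e2
    simp [hα, hβ]
    constructor
    · linarith
    · linarith
  have mem1 : τ2 ∈ Ideal.span {X 0 ^ n, X 1 ^ n} ∧ τ3 ∈ Ideal.span {X 0 ^ n, X 1 ^ n} := by
    by_cases hα1 : -1 ≤ α
    · constructor
      · rw [mem_span_X_pow]
        intro μ hμ
        have := wt2 τ2 2 (by simp) hτ2 μ hμ
        omega
      · rw [mem_span_X_pow]
        intro μ hμ
        have := wt2 τ3 3 (by simp) hτ3 μ hμ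
        omega
    · have hβ1 : β ≤ -1 := by
        by_contra hc
        have : (α + 1) * (β + 1) < 0 := mul_neg_of_neg_of_pos (by omega) (by omega)
        omega
      have hin : X 3 ^ n * τ2 - X 2 ^ n * τ3 ∈
          Ideal.span {(X 0 ^ n : MvPolynomial (Fin 4) k), X 1 ^ n} :=
        hrel ▸ Ideal.mem_span_pair.2 ⟨-σ1, σ0, by ring⟩
      rw [mem_span_X_pow] at hin
      constructor
      · rw [mem_span_X_pow]
        intro μ hμ
        have hw := wt2 τ2 2 (by simp) hτ2 μ hμ
        have := hin (Finsupp.single 3 n + μ) (by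
          rw [mem_support_iff, coeff_sub, X_pow_eq_monomial, X_pow_eq_monomial,
            coeff_monomial_mul, coeff_monomial_mul', if_neg]
          · simpa using hμ
          · intro hle
            have := hle 2
            simp at this
            omega)
        simpa using this
      · rw [mem_span_X_pow]
        intro μ hμ
        have hw := wt2 τ3 3 (by simp) hτ3 μ hμ
        have := hin (Finsupp.single 2 n + μ) (by
          rw [mem_support_iff, coeff_sub, X_pow_eq_monomial, X_pow_eq_monomial,
            coeff_monomial_mul, coeff_monomial_mul', if_neg]
          · simpa using hμ
          · intro hle
            have := hle 3
            simp at this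
            omega)
        simpa using this
  -- descend in the `s,u` direction
  have hd : ∀ j : Fin 4, (∃ c, (X j ^ n : MvPolynomial (Fin 4) k) • g = dK f c) →
      ∃ c, (X j ^ n : MvPolynomial (Fin 4) k) • g = dK f c ∧
        ∀ l, IsWeightedHomogeneous bw (c l) (n • bw j + m - dd d l) := by
    rintro j ⟨c, hc⟩
    refine dK_hom bw hf _ hc (fun l => ?_)
    have := (hXd j).mul (hg l)
    rwa [← add_sub_assoc] at this
  obtain ⟨e2, he2, de2⟩ := hd 2 (descend (hX0 0) (X_pow_coprime (by decide) n)
    (by rw [smul_smul]; exact h02) t2 mem1.1)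
  obtain ⟨e3, he3, de3⟩ := hd 3 (descend (hX0 0) (X_pow_coprime (by decide) n)
    (by rw [smul_smul]; exact h03) t3 mem1.2)
  obtain ⟨σ, hσ, dσ⟩ := exists_vF_hom bw hf hp hne (m := (0, 2 * (n : ℤ)) + m)
    (c := (X 3 ^ n : MvPolynomial (Fin 4) k) • e2 - (X 2 ^ n : MvPolynomial (Fin 4) k) • e3)
    (fun l => by
      refine IsWeightedHomogeneous.sub ?_ ?_
      · have := (hXd 3).mul (de2 l)
        refine hom_congr this ?_
        rw [b2, b3]; ext <;> simp <;> ring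
      · have := (hXd 2).mul (de3 l)
        refine hom_congr this ?_
        rw [b2, b3]; ext <;> simp <;> ring) (by
    rw [map_sub, map_smul, map_smul, ← he2, ← he3, smul_smul, smul_smul, ← sub_smul]
    ring_nf; simp)
  refine descend (hX0 2) (X_pow_coprime (by decide) n) he2 hσ ?_
  rw [mem_span_X_pow]
  intro μ hμ
  have h1 := dσ (mem_support_iff.1 hμ)
  rw [weight_bw] at h1
  have e1 := congrArg Prod.fst h1
  have e2 := congrArg Prod.snd h1
  simp at e1 e2
  have w1 : (μ 0 : ℤ) + μ 1 = α := by simp [hα]; linarith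
  have w2 : (μ 2 : ℤ) + μ 3 = 2 * n + β := by simp [hβ]; linarith
  by_cases hβ1 : -1 ≤ β
  · omega
  · exfalso
    have : (α + 1) * (β + 1) < 0 := mul_neg_of_pos_of_neg (by omega) (by omega)
    omega

end Homog

section Heights

variable {k : Type} [Field k]

/-- Homogeneity of an ideal with respect to a weight. -/
def HomI {σ M : Type*} [AddCommMonoid M] (w : σ → M) (J : Ideal (MvPolynomial σ k)) : Prop :=
  ∀ p ∈ J, ∀ n, weightedHomogeneousComponent w n p ∈ J

attribute [local instance] MvPolynomial.weightedGradedAlgebra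

lemma HomI.minimalPrime {σ : Type*} {w : σ → ℤ} {J Q : Ideal (MvPolynomial σ k)}
    (hJ : HomI w J) (hQ : Q ∈ J.minimalPrimes) : HomI w Q := by
  classical
  have hQp : Q.IsPrime := hQ.1.1
  set C := Ideal.homogeneousCore (weightedHomogeneousSubmodule k w) Q with hC
  have hCh := C.isHomogeneous
  have hle : C.toIdeal ≤ Q := Ideal.toIdeal_homogeneousCore_le _ _
  have hJC : J ≤ C.toIdeal := by
    intro p hp
    rw [mem_iff_weightedHomogeneousComponent_mem k w hCh]
    intro n
    exact Ideal.mem_homogeneousCore_of_homogeneous_of_mem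
      ⟨n, comp_hom w n p⟩ (hQ.1.2 (hJ p hp n))
  have : Q ≤ C.toIdeal := hQ.2 ⟨hQp.homogeneousCore, hJC⟩ hle
  intro p hp n
  exact hle (weightedHomogeneousComponent_mem_of_mem k w hCh (this hp) n)

lemma HomI.span {σ M : Type*} [AddCommGroup M] {w : σ → M} {f : Fin 3 → MvPolynomial σ k}
    {d : Fin 3 → M} (hf : ∀ i, IsWeightedHomogeneous w (f i) (d i)) :
    HomI w (Ideal.span {f 0, f 1, f 2}) := by
  intro p hp n
  rw [Ideal.span, Submodule.mem_span_triple] at hp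
  obtain ⟨a, b, c, rfl⟩ := hp
  rw [Ideal.span, Submodule.mem_span_triple]
  simp only [smul_eq_mul, map_add, comp_mul w (hf _)]
  exact ⟨_, _, _, rfl⟩

lemma HomI.colon {σ M : Type*} [AddCommGroup M] {w : σ → M} {f g : Fin 3 → MvPolynomial σ k}
    {d : Fin 3 → M} (hf : ∀ i, IsWeightedHomogeneous w (f i) (d i)) {m : M}
    (hg : ∀ i, IsWeightedHomogeneous w (g i) (m - d i)) :
    HomI w ((LinearMap.range (dK f)).comap (LinearMap.toSpanSingleton _ _ g)) := by
  rintro p ⟨c, hc⟩ n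
  rw [LinearMap.toSpanSingleton_apply] at hc
  have := dK_comp w hf (n + m) hc.symm
  refine ⟨_, this.symm.trans ?_⟩
  ext1 i
  rw [LinearMap.toSpanSingleton_apply, Pi.smul_apply, Pi.smul_apply, smul_eq_mul, smul_eq_mul,
    comp_mul w (hg i)]
  congr 2
  abel_nf

/-- Set the variables of positive weight to zero. -/
def phi {σ : Type*} (w : σ → ℤ) : MvPolynomial σ k →ₐ[k] MvPolynomial σ k :=
  open Classical in aeval (fun i => if w i = 0 then X i else 0)

lemma phi_eq (w : Fin 4 → ℤ) (hw : ∀ i, 0 ≤ w i) (p : MvPolynomial (Fin 4) k) :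
    phi w p = weightedHomogeneousComponent w 0 p := by
  induction p using MvPolynomial.induction_on' with
  | add p q hp hq => rw [map_add, map_add, hp, hq]
  | monomial m a =>
    have hwt : Finsupp.weight w m = 0 ↔ ∀ i, w i = 0 ∨ m i = 0 := by
      rw [Finsupp.weight_apply, Finsupp.sum_fintype _ _ (by simp), Finset.sum_eq_zero_iff_of_nonneg]
      · simp [or_comm]
      · intro i _
        simpa using mul_nonneg (Int.natCast_nonneg _) (hw i)
    have hh : IsWeightedHomogeneous w (monomial m a) (Finsupp.weight w m) :=
      isWeightedHomogeneous_monomial w m a rfl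
    rw [phi, aeval_monomial, Finsupp.prod_fintype _ _ (by simp)]
    by_cases h : Finsupp.weight w m = 0
    · rw [h] at hh
      rw [hh.weightedHomogeneousComponent_same, monomial_eq, Finsupp.prod_fintype _ _ (by simp)]
      congr 1
      refine Finset.prod_congr rfl fun i _ => ?_
      rcases hwt.1 h i with h' | h'
      · rw [if_pos h']
      · rw [h']; simp
    · rw [hh.weightedHomogeneousComponent_ne _ (fun h' => h h'.symm)]
      obtain ⟨i, hi⟩ : ∃ i, ¬ (w i = 0 ∨ m i = 0) := by
        by_contra hc; push Not at hc
        exact h (hwt.2 hc)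
      push Not at hi
      rw [Finset.prod_eq_zero (Finset.mem_univ i), mul_zero]
      rw [if_neg hi.1, zero_pow hi.2]

lemma phi_comm (w w' : Fin 4 → ℤ) (p : MvPolynomial (Fin 4) k) :
    phi w (phi w' p) = phi w' (phi w p) := by
  have : (phi w).comp (phi w') = ((phi w').comp (phi w) : MvPolynomial (Fin 4) k →ₐ[k] _) := by
    ext1 i
    simp only [AlgHom.comp_apply, phi, aeval_X]
    by_cases h : w i = 0 <;> by_cases h' : w' i = 0 <;> simp [h, h']
  exact DFunLike.congr_fun this p

lemma height_le_two {w₁ w₂ : Fin 4 → ℤ} (hw₁ : ∀ i, 0 ≤ w₁ i) (hw₂ : ∀ i, 0 ≤ w₂ i)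
    {Q : Ideal (MvPolynomial (Fin 4) k)} [hQ : Q.IsPrime] (h1 : HomI w₁ Q) (h2 : HomI w₂ Q)
    {i j : Fin 4} (hi : X i ∉ Q) (hj : X j ∉ Q) (hi1 : w₁ i ≠ 0)
    (hj1 : w₁ j = 0) (hj2 : w₂ j ≠ 0) : Q.height ≤ 2 := by
  let Q₁ := Q.comap (phi w₁)
  let Q₂ := Q₁.comap (phi w₂)
  have p1 : Q₁.IsPrime := Ideal.comap_isPrime _ _
  have p2 : Q₂.IsPrime := Ideal.comap_isPrime _ _
  have l1 : Q < Q₁ := by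
    refine lt_of_le_of_ne ?_ ?_
    · intro q hq
      change phi w₁ q ∈ Q
      rw [phi_eq w₁ hw₁]
      exact h1 q hq 0
    · intro h
      apply hi
      rw [h]
      change phi w₁ (X i) ∈ Q
      simp [phi, hi1]
  have l2 : Q₁ < Q₂ := by
    refine lt_of_le_of_ne ?_ ?_
    · intro q hq
      change phi w₁ (phi w₂ q) ∈ Q
      rw [phi_comm, phi_eq w₂ hw₂]
      exact h2 _ hq 0
    · intro h
      have : X j ∈ Q₂ := by
        change phi w₁ (phi w₂ (X j)) ∈ Q
        simp [phi, hj2]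
      rw [← h] at this
      change phi w₁ (X j) ∈ Q at this
      simp [phi, hj1] at this
      exact hj this
  have a1 := Ideal.height_add_one_le_of_lt_of_isPrime l1
  have a2 := Ideal.height_add_one_le_of_lt_of_isPrime l2
  have a3 := Ideal.height_le_ringKrullDim_of_ne_top p2.ne_top
  rw [ringKrullDim_of_isNoetherianRing, ringKrullDim_eq_zero_of_field] at a3
  simp only [Nat.card_eq_fintype_card, Fintype.card_fin, zero_add] at a3
  have a4 : Q₂.height ≤ 4 := WithBot.coe_le_coe.1 a3
  have a5 : Q.height + 2 ≤ 2 + 2 := by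
    calc Q.height + 2 = Q.height + 1 + 1 := by rw [add_assoc]; rfl
      _ ≤ Q₁.height + 1 := by gcongr
      _ ≤ Q₂.height := a2
      _ ≤ 4 := a4
      _ = 2 + 2 := by norm_num
  exact (ENat.add_le_add_iff_right (by decide)).1 a5

/-- First and second components of the bigrading. -/
def bw₁ (i : Fin 4) : ℤ := (bw i).1
/-- Second component of the bigrading. -/
def bw₂ (i : Fin 4) : ℤ := (bw i).2

lemma bw₁_nonneg (i : Fin 4) : 0 ≤ bw₁ i := by fin_cases i <;> simp [bw₁, bw]
lemma bw₂_nonneg (i : Fin 4) : 0 ≤ bw₂ i := by fin_cases i <;> simp [bw₂, bw]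

lemma hom_bw₁ {p : MvPolynomial (Fin 4) k} {m : ℤ × ℤ} (h : IsWeightedHomogeneous bw p m) :
    IsWeightedHomogeneous bw₁ p m.1 := by
  intro μ hμ
  rw [← h hμ, weight_bw, Finsupp.weight_apply, Finsupp.sum_fintype _ _ (by simp),
    Fin.sum_univ_four]
  simp [bw₁, bw]

lemma hom_bw₂ {p : MvPolynomial (Fin 4) k} {m : ℤ × ℤ} (h : IsWeightedHomogeneous bw p m) :
    IsWeightedHomogeneous bw₂ p m.2 := by
  intro μ hμ
  rw [← h hμ, weight_bw, Finsupp.weight_apply, Finsupp.sum_fintype _ _ (by simp),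
    Fin.sum_univ_four]
  simp [bw₂, bw]

lemma irrel_not_le {Q : Ideal (MvPolynomial (Fin 4) k)} (h : ¬ irrel k ≤ Q) :
    ∃ i ∈ ({0, 1} : Set (Fin 4)), ∃ j ∈ ({2, 3} : Set (Fin 4)), X i * X j ∉ Q := by
  by_contra hc
  push Not at hc
  apply h
  rw [irrel, Ideal.span_le]
  rintro x (rfl | rfl | rfl | rfl)
  · exact hc 0 (by simp) 2 (by simp)
  · exact hc 0 (by simp) 3 (by simp)
  · exact hc 1 (by simp) 2 (by simp)
  · exact hc 1 (by simp) 3 (by simp)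

lemma height_le_two' {Q : Ideal (MvPolynomial (Fin 4) k)} [hQ : Q.IsPrime]
    (h1 : HomI bw₁ Q) (h2 : HomI bw₂ Q) (h : ¬ irrel k ≤ Q) : Q.height ≤ 2 := by
  obtain ⟨i, hi, j, hj, hij⟩ := irrel_not_le h
  refine height_le_two bw₁_nonneg bw₂_nonneg h1 h2 (i := i) (j := j)
    (fun h => hij (Ideal.mul_mem_right _ _ h)) (fun h => hij (Ideal.mul_mem_left _ _ h)) ?_ ?_ ?_
  · rcases hi with rfl | rfl <;> simp [bw₁, bw]
  · rcases hj with rfl | rfl <;> simp [bw₁, bw]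
  · rcases hj with rfl | rfl <;> simp [bw₂, bw]

lemma two_le_height {A : Type*} [CommRing A] {I : Ideal A} (h : idealHeight I = 2) {Q : Ideal A}
    [hQ : Q.IsPrime] (hIQ : I ≤ Q) : 2 ≤ Q.height := by
  rw [← h, PrimeSpectrum.height_eq_orderHeight ⟨Q, hQ⟩]
  exact iInf₂_le (⟨Q, hQ⟩ : PrimeSpectrum A) hIQ

lemma not_dvd_all {A : Type*} [CommRing A] [IsNoetherianRing A] {f : Fin 3 → A}
    (h : idealHeight (Ideal.span {f 0, f 1, f 2}) = 2) (p : A) (hp : Prime p) :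
    ∃ i, ¬ p ∣ f i := by
  by_contra hc
  push Not at hc
  have hpp : (Ideal.span {p}).IsPrime := (Ideal.span_singleton_prime hp.ne_zero).2 hp
  have h1 := Ideal.height_span_singleton_le_one hp.not_isUnit
  have h2 : 2 ≤ (Ideal.span {p}).height := two_le_height h (by
    rw [Ideal.span_le]
    rintro x (rfl | rfl | rfl) <;> exact Ideal.mem_span_singleton.2 (hc _))
  have := h2.trans h1
  exact absurd this (by decide)

lemma exists_ne_zero {A : Type*} [CommRing A] [IsDomain A] {f : Fin 3 → A}
    (h : idealHeight (Ideal.span {f 0, f 1, f 2}) = 2) : ∃ i, f i ≠ 0 := by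
  by_contra hc
  push Not at hc
  have h2 : 2 ≤ (⊥ : Ideal A).height := two_le_height h (by
    rw [Ideal.span_le]
    rintro x (rfl | rfl | rfl) <;> simp [hc])
  rw [Ideal.height_bot] at h2
  exact absurd h2 (by decide)

end Heights

section Backward

lemma loc_clear {A : Type*} [CommRing A] [IsDomain A] (P : Ideal A) [P.IsPrime]
    {f g : Fin 3 → A} {c : Fin 3 → Localization.AtPrime P}
    (h : (fun i => algebraMap A (Localization.AtPrime P) (g i)) =
      dK (fun i => algebraMap A (Localization.AtPrime P) (f i)) c) :
    ∃ r, r ∉ P ∧ ∃ c, r • g = dK f c := by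
  obtain ⟨b, hb⟩ := IsLocalization.exist_integer_multiples_of_finite P.primeCompl c
  choose e he using hb
  refine ⟨b, b.2, e, ?_⟩
  have hinj : Function.Injective (algebraMap A (Localization.AtPrime P)) :=
    IsLocalization.injective _ P.primeCompl_le_nonZeroDivisors
  have h0 := congrFun h 0
  have h1 := congrFun h 1
  have h2 := congrFun h 2
  have e0 := he 0
  have e1 := he 1
  have e2 := he 2
  simp only [Algebra.smul_def] at e0 e1 e2
  simp [dK] at h0 h1 h2
  ext i
  apply hinj
  fin_cases i <;> simp [dK]
  · rw [h0, e0, e1]; ring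
  · rw [h1, e0, e2]; ring
  · rw [h2, e1, e2]; ring

lemma loc_bwd {A : Type*} [CommRing A] [IsDomain A] (P : Ideal A) [P.IsPrime]
    {f g : Fin 3 → A} {x y : Localization.AtPrime P}
    (hI : (Ideal.span {f 0, f 1, f 2}).map (algebraMap A (Localization.AtPrime P)) =
      Ideal.span {x, y}) (hreg : RingTheory.Sequence.IsRegular (Localization.AtPrime P) [x, y])
    {r₀ : A} (hr₀ : r₀ ∉ P) (hr : ∀ i, r₀ * g i ∈ Ideal.span {f 0, f 1, f 2})
    (hs : g 0 * f 0 + g 1 * f 1 + g 2 * f 2 = 0) : ∃ r, r ∉ P ∧ ∃ c, r • g = dK f c := by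
  have : IsDomain (Localization.AtPrime P) :=
    IsLocalization.isDomain_localization P.primeCompl_le_nonZeroDivisors
  obtain ⟨h1, h2, h3⟩ := sreg_iff_isRegular.1 hreg
  set φ := algebraMap A (Localization.AtPrime P) with hφ
  have hm : ∀ i, φ (r₀ * g i) ∈ Ideal.span {x, y} := fun i => by
    rw [← hI]; exact Ideal.mem_map_of_mem _ (hr i)
  have hK := local_bwd (f₀ := φ (f 0)) (f₁ := φ (f 1)) (f₂ := φ (f 2)) h1 h2 h3 (by
    rw [← hI, Ideal.map_span, Set.image_insert_eq, Set.image_pair]) (hm 0) (hm 1) (hm 2) (by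
    simp only [← map_mul, ← map_add]
    rw [show r₀ * g 0 * f 0 + r₀ * g 1 * f 1 + r₀ * g 2 * f 2 =
      r₀ * (g 0 * f 0 + g 1 * f 1 + g 2 * f 2) by ring, hs, mul_zero, map_zero])
  obtain ⟨c, hc⟩ := (kosEq_iff (fun i => φ (f i)) (fun i => φ (r₀ * g i))).1 hK
  obtain ⟨r, hrP, e, he⟩ := loc_clear P (g := fun i => r₀ * g i) hc
  refine ⟨r * r₀, fun h => ((‹P.IsPrime›.mem_or_mem h).elim hrP hr₀), e, ?_⟩
  rw [← he]
  ext i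
  simp [mul_assoc]

lemma I_le_colon {A : Type*} [CommRing A] {f g : Fin 3 → A}
    (hs : g 0 * f 0 + g 1 * f 1 + g 2 * f 2 = 0) : Ideal.span {f 0, f 1, f 2} ≤
      (LinearMap.range (dK f)).comap (LinearMap.toSpanSingleton _ _ g) := by
  rw [Ideal.span_le]
  rintro x (rfl | rfl | rfl)
  · refine ⟨![-g 1, -g 2, 0], ?_⟩
    ext i; fin_cases i <;> simp [dK]
    · linear_combination -hs
    · ring
    · ring
  · refine ⟨![g 0, 0, -g 2], ?_⟩
    ext i; fin_cases i <;> simp [dK]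
    · ring
    · linear_combination -hs
    · ring
  · refine ⟨![0, g 0, g 1], ?_⟩
    ext i; fin_cases i <;> simp [dK]
    · ring
    · ring
    · linear_combination -hs

lemma kos_syz {A : Type*} [CommRing A] (f c : Fin 3 → A) :
    dK f c 0 * f 0 + dK f c 1 * f 1 + dK f c 2 * f 2 = 0 := by
  simp [dK]; ring

lemma kos_mem {A : Type*} [CommRing A] (f c : Fin 3 → A) (i : Fin 3) :
    dK f c i ∈ Ideal.span {f 0, f 1, f 2} := by
  have h0 : f 0 ∈ Ideal.span {f 0, f 1, f 2} := Ideal.subset_span (by simp)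
  have h1 : f 1 ∈ Ideal.span {f 0, f 1, f 2} := Ideal.subset_span (by simp)
  have h2 : f 2 ∈ Ideal.span {f 0, f 1, f 2} := Ideal.subset_span (by simp)
  fin_cases i <;> simp [dK]
  · exact add_mem (Ideal.mul_mem_left _ _ h1) (Ideal.mul_mem_left _ _ h2)
  · exact add_mem (neg_mem (Ideal.mul_mem_left _ _ h0)) (Ideal.mul_mem_left _ _ h2)
  · exact sub_mem (neg_mem (Ideal.mul_mem_left _ _ h0)) (Ideal.mul_mem_left _ _ h1)

variable {k : Type} [Field k]

lemma exists_common_pow {Q I : Ideal (MvPolynomial (Fin 4) k)} [hQ : Q.IsPrime]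
    (hQ' : ¬ irrel k ≤ Q) {g : Fin 3 → MvPolynomial (Fin 4) k}
    (hg : ∀ i, g i ∈ Ideal.sat (irrel k) I) : ∃ r, r ∉ Q ∧ ∀ i, r * g i ∈ I := by
  choose j hj using hg
  obtain ⟨y, hy, hyQ⟩ := SetLike.not_le_iff_exists.1 hQ'
  refine ⟨y ^ (j 0 + j 1 + j 2), fun h => hyQ (hQ.mem_of_pow_mem _ h), fun i => ?_⟩
  have : j i ≤ j 0 + j 1 + j 2 := by fin_cases i <;> simp <;> omega
  obtain ⟨e, he⟩ := Nat.exists_eq_add_of_le this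
  rw [he, pow_add, mul_comm (y ^ j i), mul_assoc]
  exact Ideal.mul_mem_left _ _ (hj i _ (Ideal.pow_mem_pow hy _))

lemma main_bwd {f : Fin 3 → MvPolynomial (Fin 4) k} {d : Fin 3 → ℤ × ℤ}
    (hf : ∀ i, IsWeightedHomogeneous bw (f i) (d i))
    (hht : idealHeight (Ideal.span {f 0, f 1, f 2}) = 2)
    {g : Fin 3 → MvPolynomial (Fin 4) k} {m : ℤ × ℤ}
    (hg : ∀ i, IsWeightedHomogeneous bw (g i) (m - d i))
    (hm : ((m - d 0 - d 1 - d 2).1 + 1) * ((m - d 0 - d 1 - d 2).2 + 1) ≥ 0)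
    (hs : g 0 * f 0 + g 1 * f 1 + g 2 * f 2 = 0)
    (hloc : ∀ P ∈ (Ideal.span {f 0, f 1, f 2}).minimalPrimes, ∃ r, r ∉ P ∧ ∃ c, r • g = dK f c) :
    ∃ c, g = dK f c := by
  set 𝔞 : Ideal (MvPolynomial (Fin 4) k) :=
    (LinearMap.range (dK f)).comap (LinearMap.toSpanSingleton _ _ g) with h𝔞
  have hIa : Ideal.span {f 0, f 1, f 2} ≤ 𝔞 := I_le_colon hs
  have H1 : HomI bw₁ 𝔞 := HomI.colon (fun i => hom_bw₁ (hf i)) (m := m.1)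
    (fun i => hom_bw₁ (hg i))
  have H2 : HomI bw₂ 𝔞 := HomI.colon (fun i => hom_bw₂ (hf i)) (m := m.2)
    (fun i => hom_bw₂ (hg i))
  have hrad : irrel k ≤ 𝔞.radical := by
    rw [← Ideal.sInf_minimalPrimes]
    refine le_sInf fun Q hQ => ?_
    by_contra hc
    have hQp : Q.IsPrime := hQ.1.1
    have hle := height_le_two' (H1.minimalPrime hQ) (H2.minimalPrime hQ) hc
    have hIQ := hIa.trans hQ.1.2
    have hQmin : Q ∈ (Ideal.span {f 0, f 1, f 2}).minimalPrimes := by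
      refine ⟨⟨hQp, hIQ⟩, ?_⟩
      rintro Q' ⟨hQ'p, hIQ'⟩ hQ'Q
      have hQ'p : Q'.IsPrime := hQ'p
      by_contra hne
      have h3 := Ideal.height_add_one_le_of_lt_of_isPrime (lt_of_le_not_ge hQ'Q hne)
      have h4 := two_le_height hht hIQ'
      have : (2 : ℕ∞) + 1 ≤ 2 := (add_le_add_left h4 1).trans (h3.trans hle)
      exact absurd this (by decide)
    obtain ⟨r, hr, c, hc⟩ := hloc Q hQmin
    exact hr (hQ.1.2 ⟨c, hc.symm⟩)
  have hpow : ∀ i ∈ ({0, 1} : Set (Fin 4)), ∀ j ∈ ({2, 3} : Set (Fin 4)), ∃ n : ℕ,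
      (X i * X j : MvPolynomial (Fin 4) k) ^ n ∈ 𝔞 := by
    intro i hi j hj
    apply hrad
    apply Ideal.subset_span
    rcases hi with rfl | rfl <;> rcases hj with rfl | rfl <;> simp
  obtain ⟨n1, hn1⟩ := hpow 0 (by simp) 2 (by simp)
  obtain ⟨n2, hn2⟩ := hpow 0 (by simp) 3 (by simp)
  obtain ⟨n3, hn3⟩ := hpow 1 (by simp) 2 (by simp)
  obtain ⟨n4, hn4⟩ := hpow 1 (by simp) 3 (by simp)
  refine sat_to_kos hf (not_dvd_all hht) (exists_ne_zero hht) hg hm (n1 + n2 + n3 + n4) ?_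
  have key : ∀ i j : Fin 4, ∀ n ≤ n1 + n2 + n3 + n4,
      (X i * X j : MvPolynomial (Fin 4) k) ^ n ∈ 𝔞 →
      ∃ c, (X i ^ (n1 + n2 + n3 + n4) * X j ^ (n1 + n2 + n3 + n4) :
        MvPolynomial (Fin 4) k) • g = dK f c := by
    intro i j n hn h
    rw [← mul_pow]
    obtain ⟨c, hc⟩ := Ideal.pow_mem_of_pow_mem _ h hn
    exact ⟨c, hc.symm⟩
  rintro i (rfl | rfl) j (rfl | rfl)
  · exact key _ _ _ (by omega) hn1
  · exact key _ _ _ (by omega) hn2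
  · exact key _ _ _ (by omega) hn3
  · exact key _ _ _ (by omega) hn4

end Backward

section Forward

lemma exists_avoid {A : Type*} [CommRing A] [IsDomain A] [UniqueFactorizationMonoid A] (y : A) :
    ∀ x : A, x ≠ 0 → ∃ c : A, (∀ p, Prime p → p ∣ c → ¬ p ∣ y) ∧
      ∀ p, Prime p → p ∣ x → ¬ p ∣ y → p ∣ c := by
  intro x
  induction x using UniqueFactorizationMonoid.induction_on_prime with
  | h₁ => intro h; exact absurd rfl h
  | h₂ x hx =>
    intro _
    exact ⟨1, fun p hp h => absurd (isUnit_of_dvd_one h) hp.not_isUnit,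
      fun p hp h => absurd (isUnit_of_dvd_unit h hx) hp.not_isUnit⟩
  | h₃ a q ha hq ih =>
    intro _
    obtain ⟨c, h1, h2⟩ := ih ha
    by_cases hqy : q ∣ y
    · refine ⟨c, h1, fun p hp hpx hpy => ?_⟩
      rcases hp.dvd_or_dvd hpx with h | h
      · exact absurd (((hp.dvd_prime_iff_associated hq).1 h).dvd.trans hqy) hpy
      · exact h2 p hp h hpy
    · refine ⟨q * c, fun p hp hpc hpy => ?_, fun p hp hpx hpy => ?_⟩
      · rcases hp.dvd_or_dvd hpc with h | h
        · exact hqy (((hp.dvd_prime_iff_associated hq).1 h).symm.dvd.trans hpy)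
        · exact h1 p hp h hpy
      · rcases hp.dvd_or_dvd hpx with h | h
        · exact h.mul_right _
        · exact (h2 p hp h hpy).mul_left _

lemma exists_coprime {A : Type*} [CommRing A] [IsDomain A] [UniqueFactorizationMonoid A]
    {f : Fin 3 → A} (hp : ∀ p, Prime p → ∃ i, ¬ p ∣ f i) (h0 : f 0 ≠ 0) :
    ∃ c, ∀ p, Prime p → p ∣ f 0 → ¬ p ∣ f 1 + c * f 2 := by
  obtain ⟨c, h1, h2⟩ := exists_avoid (f 1) (f 0) h0
  refine ⟨c, fun p hpp hp0 hps => ?_⟩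
  by_cases hp1 : p ∣ f 1
  · have h3 := (dvd_add_right hp1).1 hps
    rcases hpp.dvd_or_dvd h3 with h | h
    · exact h1 p hpp h hp1
    · obtain ⟨i, hi⟩ := hp p hpp
      fin_cases i
      · exact hi hp0
      · exact hi hp1
      · exact hi h
  · have h3 := h2 p hpp hp0 hp1
    exact hp1 ((dvd_add_left (h3.mul_right _)).1 hps)

lemma sreg_of_coprime {A : Type*} [CommRing A] [IsDomain A] [UniqueFactorizationMonoid A]
    {x y : A} (hx : x ≠ 0) (h : ∀ p, Prime p → p ∣ x → ¬ p ∣ y) : SReg x y := by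
  intro a b hab
  have hd : x ∣ b * y := ⟨-a, by linear_combination hab⟩
  obtain ⟨t, rfl⟩ := UniqueFactorizationMonoid.dvd_of_dvd_mul_left_of_no_prime_factors hx
    (fun {d} hd1 hd2 hd3 => h d hd3 hd1 hd2) hd
  refine ⟨-t, ?_, by ring⟩
  apply mul_left_cancel₀ hx
  linear_combination hab

lemma SReg.localize {A : Type*} [CommRing A] [IsDomain A] (P : Ideal A) [P.IsPrime] {x y : A}
    (h : SReg x y) : SReg (algebraMap A (Localization.AtPrime P) x)
      (algebraMap A (Localization.AtPrime P) y) := by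
  intro a b hab
  obtain ⟨s, hs⟩ := IsLocalization.exist_integer_multiples_of_finite P.primeCompl ![a, b]
  obtain ⟨a', ha'⟩ := hs 0
  obtain ⟨b', hb'⟩ := hs 1
  simp [Algebra.smul_def] at ha' hb'
  have hinj : Function.Injective (algebraMap A (Localization.AtPrime P)) :=
    IsLocalization.injective _ P.primeCompl_le_nonZeroDivisors
  obtain ⟨e, he1, he2⟩ := h a' b' (by
    apply hinj
    simp only [map_add, map_mul, map_zero, ha', hb']
    linear_combination (algebraMap A (Localization.AtPrime P) s) * hab)
  obtain ⟨u, hu⟩ := IsLocalization.map_units (Localization.AtPrime P) s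
  have hu' : (↑u⁻¹ : Localization.AtPrime P) * algebraMap A (Localization.AtPrime P) s = 1 := by
    rw [← hu]; simp
  rw [he1] at ha'
  rw [he2] at hb'
  simp only [map_mul, map_neg] at ha' hb'
  refine ⟨↑u⁻¹ * algebraMap A _ e, ?_, ?_⟩
  · linear_combination (-a) * hu' - (↑u⁻¹ : Localization.AtPrime P) * ha'
  · linear_combination (-b) * hu' - (↑u⁻¹ : Localization.AtPrime P) * hb'

/-- Every syzygy with entries in the ideal is, locally at `P`, Koszul. -/
def LocK {A : Type*} [CommRing A] (P : Ideal A) (f : Fin 3 → A) : Prop :=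
  ∀ g : Fin 3 → A, (∀ i, g i ∈ Ideal.span {f 0, f 1, f 2}) →
    g 0 * f 0 + g 1 * f 1 + g 2 * f 2 = 0 → ∃ r, r ∉ P ∧ ∃ c, r • g = dK f c

lemma span_rot {A : Type*} [CommRing A] (x y z : A) :
    Ideal.span {y, z, x} = Ideal.span {x, y, z} := by
  congr 1; ext; simp; tauto

lemma LocK.rot {A : Type*} [CommRing A] {P : Ideal A} {f : Fin 3 → A} (h : LocK P f) :
    LocK P ![f 1, f 2, f 0] := by
  intro g hg hs
  simp at hg hs
  rw [span_rot] at hg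
  obtain ⟨r, hr, c, hc⟩ := h ![g 2, g 0, g 1] (by
    intro i; fin_cases i
    · exact hg 2
    · exact hg 0
    · exact hg 1) (by simp; linear_combination hs)
  refine ⟨r, hr, ?_⟩
  have h1 := (kosEq_iff f (r • ![g 2, g 0, g 1])).2 ⟨c, hc⟩
  apply (kosEq_iff ![f 1, f 2, f 0] (r • g)).1
  exact KosEq.perm₂ (KosEq.perm₂ h1)

lemma min_loc {A : Type*} [CommRing A] [IsDomain A] [IsNoetherianRing A]
    [UniqueFactorizationMonoid A] (P : Ideal A) [hP : P.IsPrime] (hht : P.height ≤ 2) {x y : A}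
    (hx : x ≠ 0) (h : ∀ p, Prime p → p ∣ x → ¬ p ∣ y) (hxP : x ∈ P) (hyP : y ∈ P) :
    IsLocalRing.maximalIdeal (Localization.AtPrime P) ∈
      (Ideal.span {algebraMap A (Localization.AtPrime P) x,
        algebraMap A (Localization.AtPrime P) y}).minimalPrimes := by
  have hmax := Localization.AtPrime.map_eq_maximalIdeal (I := P)
  refine ⟨⟨inferInstance, ?_⟩, ?_⟩
  · rw [Ideal.span_le, ← hmax]
    rintro z (rfl | rfl)
    · exact Ideal.mem_map_of_mem _ hxP
    · exact Ideal.mem_map_of_mem _ hyP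
  · rintro Q' ⟨hQ'p, hle⟩ hQ'm
    have hQ'p : Q'.IsPrime := hQ'p
    rw [← hmax, Ideal.map_le_iff_le_comap]
    by_contra hc
    set Q := Q'.comap (algebraMap A (Localization.AtPrime P)) with hQ
    have hQp : Q.IsPrime := Ideal.comap_isPrime _ _
    have hQP : Q ≤ P := by
      have := Ideal.comap_mono (f := algebraMap A (Localization.AtPrime P)) hQ'm
      refine this.trans (le_of_eq ?_)
      exact Localization.AtPrime.under_maximalIdeal
    have hxQ : x ∈ Q := hle (Ideal.subset_span (by simp))
    have hyQ : y ∈ Q := hle (Ideal.subset_span (by simp))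
    have hQ0 : Q ≠ ⊥ := fun h0 => hx (by rw [h0] at hxQ; simpa using hxQ)
    obtain ⟨π, hπ, hπp⟩ := hQp.exists_mem_prime_of_ne_bot hQ0
    have hpp : (Ideal.span {π}).IsPrime := (Ideal.span_singleton_prime hπp.ne_zero).2 hπp
    have l1 : (⊥ : Ideal A) < Ideal.span {π} := bot_lt_iff_ne_bot.2 (by
      simpa using hπp.ne_zero)
    have l2 : Ideal.span {π} < Q := by
      refine lt_of_le_of_ne ((Ideal.span_singleton_le_iff_mem _).2 hπ) (fun he => ?_)
      rw [← he, Ideal.mem_span_singleton] at hxQ hyQ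
      exact h π hπp hxQ hyQ
    have l3 : Q < P := lt_of_le_not_ge hQP hc
    have a1 := Ideal.height_add_one_le_of_lt_of_isPrime l1
    have a2 := Ideal.height_add_one_le_of_lt_of_isPrime l2
    have a3 := Ideal.height_add_one_le_of_lt_of_isPrime l3
    rw [Ideal.height_bot] at a1
    have : (0 : ℕ∞) + 1 + 1 + 1 ≤ 2 :=
      calc (0 : ℕ∞) + 1 + 1 + 1 ≤ (Ideal.span {π}).height + 1 + 1 := by gcongr
        _ ≤ Q.height + 1 := by gcongr
        _ ≤ P.height := a3
        _ ≤ 2 := hht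
    exact absurd this (by decide)

lemma fwd_ring {A : Type*} [CommRing A] [IsDomain A] [IsNoetherianRing A]
    [UniqueFactorizationMonoid A] (P : Ideal A) [hP : P.IsPrime] (hht : P.height ≤ 2)
    {f : Fin 3 → A} (hp : ∀ p, Prime p → ∃ i, ¬ p ∣ f i) (h0 : f 0 ≠ 0)
    (hIP : Ideal.span {f 0, f 1, f 2} ≤ P) {x y : Localization.AtPrime P}
    (hm : IsLocalRing.maximalIdeal (Localization.AtPrime P) = Ideal.span {x, y})
    (hK : LocK P f) :
    ∃ z w : Localization.AtPrime P,
      (Ideal.span {f 0, f 1, f 2}).map (algebraMap A (Localization.AtPrime P)) =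
          Ideal.span {z, w} ∧
        RingTheory.Sequence.IsRegular (Localization.AtPrime P) [z, w] := by
  have : IsDomain (Localization.AtPrime P) :=
    IsLocalization.isDomain_localization P.primeCompl_le_nonZeroDivisors
  have : IsNoetherianRing (Localization.AtPrime P) :=
    IsLocalization.isNoetherianRing P.primeCompl _ inferInstance
  obtain ⟨c, hc⟩ := exists_coprime hp h0
  set φ := algebraMap A (Localization.AtPrime P) with hφ
  have hinj : Function.Injective φ :=
    IsLocalization.injective _ P.primeCompl_le_nonZeroDivisors
  have m0 : f 0 ∈ Ideal.span {f 0, f 1, f 2} := Ideal.subset_span (by simp)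
  have m1 : f 1 ∈ Ideal.span {f 0, f 1, f 2} := Ideal.subset_span (by simp)
  have m2 : f 2 ∈ Ideal.span {f 0, f 1, f 2} := Ideal.subset_span (by simp)
  have mg : f 1 + c * f 2 ∈ Ideal.span {f 0, f 1, f 2} := add_mem m1 (Ideal.mul_mem_left _ _ m2)
  have hspan : (Ideal.span {f 0, f 1, f 2}).map φ =
      Ideal.span {φ (f 0), φ (f 1 + c * f 2)} ⊔ Ideal.span {φ (f 2)} := by
    have : Ideal.span {f 0, f 1, f 2} =
        Ideal.span {f 0, f 1 + c * f 2} ⊔ Ideal.span {f 2} := by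
      apply le_antisymm
      · have k0 : f 0 ∈ Ideal.span {f 0, f 1 + c * f 2} ⊔ Ideal.span {f 2} :=
          Ideal.mem_sup_left (Ideal.subset_span (by simp))
        have k2 : f 2 ∈ Ideal.span {f 0, f 1 + c * f 2} ⊔ Ideal.span {f 2} :=
          Ideal.mem_sup_right (Ideal.subset_span (by simp))
        have kg : f 1 + c * f 2 ∈ Ideal.span {f 0, f 1 + c * f 2} ⊔ Ideal.span {f 2} :=
          Ideal.mem_sup_left (Ideal.subset_span (by simp))
        rw [Ideal.span_le]
        rintro z (rfl | rfl | rfl)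
        · exact k0
        · have := sub_mem kg (Ideal.mul_mem_left _ c k2)
          simpa using this
        · exact k2
      · refine sup_le ?_ ?_
        · rw [Ideal.span_le]
          rintro z (rfl | rfl)
          · exact m0
          · exact mg
        · rw [Ideal.span_le]
          rintro z rfl
          exact m2
    rw [this, Ideal.map_sup, Ideal.map_span, Ideal.map_span, Set.image_pair, Set.image_singleton]
  have hnu : ∀ z ∈ Ideal.span {f 0, f 1, f 2}, ¬ IsUnit (φ z) := by
    intro z hz hu
    rw [hφ, IsLocalization.AtPrime.isUnit_to_map_iff _ P] at hu
    exact hu (hIP hz)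
  obtain ⟨z, w, h1, h2, h3, h4⟩ := local_fwd hm (hnu _ m0) (hnu _ mg) (hnu _ m2)
    ((sreg_of_coprime h0 hc).localize P) (min_loc P hht h0 hc (hIP m0) (hIP mg)) (by
      intro a b e ha hb he hs
      rw [← hspan, hφ, IsLocalization.mem_map_algebraMap_iff P.primeCompl] at ha hb he
      obtain ⟨⟨⟨a1, ha1⟩, s1⟩, ha⟩ := ha
      obtain ⟨⟨⟨b1, hb1⟩, s2⟩, hb⟩ := hb
      obtain ⟨⟨⟨e1, he1⟩, s3⟩, he⟩ := he
      simp only [← hφ] at ha hb he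
      obtain ⟨r, hr, q, hq⟩ := hK ![a1 * (s2 * s3), b1 * (s1 * s3),
          e1 * (s1 * s2) + c * (b1 * (s1 * s3))] (by
        intro i; fin_cases i
        · exact Ideal.mul_mem_right _ _ ha1
        · exact Ideal.mul_mem_right _ _ hb1
        · exact add_mem (Ideal.mul_mem_right _ _ he1)
            (Ideal.mul_mem_left _ _ (Ideal.mul_mem_right _ _ hb1))) (by
        apply hinj
        simp only [Matrix.cons_val, map_add, map_mul, map_zero, ← ha, ← hb, ← he] at hs ⊢
        linear_combination (φ s1 * φ s2 * φ s3) * hs)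
      have q1 : r * (b1 * (s1 * s3)) = -(q 0 * f 0) + q 2 * f 2 := by
        simpa [dK] using congrFun hq 1
      have q2 : r * (e1 * (s1 * s2) + c * (b1 * (s1 * s3))) = -(q 1 * f 0) - q 2 * f 1 := by
        simpa [dK] using congrFun hq 2
      have q3 : (r * (s1 * s2 * s3) : A) ∈ P.primeCompl :=
        P.primeCompl.mul_mem hr (mul_mem (mul_mem s1.2 s2.2) s3.2)
      have hu : IsUnit (φ (r * (s1 * s2 * s3))) :=
        IsLocalization.map_units (Localization.AtPrime P) (⟨_, q3⟩ : P.primeCompl)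
      rw [← Ideal.unit_mul_mem_iff_mem _ hu, Ideal.mem_span_pair]
      refine ⟨φ (c * q 0 - q 1), φ (-q 2), ?_⟩
      have q4 : r * (e1 * (s1 * s2)) = (c * q 0 - q 1) * f 0 + (-q 2) * (f 1 + c * f 2) := by
        linear_combination q2 - c * q1
      have q5 := congrArg φ q4
      simp only [map_add, map_mul] at q5 ⊢
      rw [← he] at q5
      linear_combination -q5)
  exact ⟨z, w, hspan.trans h1, sreg_iff_isRegular.2 ⟨h2, h3, h4⟩⟩

lemma fwd_ring' {A : Type*} [CommRing A] [IsDomain A] [IsNoetherianRing A]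
    [UniqueFactorizationMonoid A] (P : Ideal A) [hP : P.IsPrime] (hht : P.height ≤ 2)
    {f : Fin 3 → A} (hp : ∀ p, Prime p → ∃ i, ¬ p ∣ f i) (hne : ∃ i, f i ≠ 0)
    (hIP : Ideal.span {f 0, f 1, f 2} ≤ P) {x y : Localization.AtPrime P}
    (hm : IsLocalRing.maximalIdeal (Localization.AtPrime P) = Ideal.span {x, y})
    (hK : LocK P f) :
    ∃ z w : Localization.AtPrime P,
      (Ideal.span {f 0, f 1, f 2}).map (algebraMap A (Localization.AtPrime P)) =
          Ideal.span {z, w} ∧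
        RingTheory.Sequence.IsRegular (Localization.AtPrime P) [z, w] := by
  have hp1 : ∀ p, Prime p → ∃ i, ¬ p ∣ (![f 1, f 2, f 0] : Fin 3 → A) i := by
    intro p hpp
    obtain ⟨i, hi⟩ := hp p hpp
    fin_cases i
    · exact ⟨2, hi⟩
    · exact ⟨0, hi⟩
    · exact ⟨1, hi⟩
  have hp2 : ∀ p, Prime p → ∃ i, ¬ p ∣ (![f 2, f 0, f 1] : Fin 3 → A) i := by
    intro p hpp
    obtain ⟨i, hi⟩ := hp p hpp
    fin_cases i
    · exact ⟨1, hi⟩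
    · exact ⟨2, hi⟩
    · exact ⟨0, hi⟩
  have e1 : Ideal.span {f 1, f 2, f 0} = Ideal.span {f 0, f 1, f 2} := span_rot _ _ _
  have e2 : Ideal.span {f 2, f 0, f 1} = Ideal.span {f 0, f 1, f 2} :=
    (span_rot _ _ _).trans e1
  obtain ⟨i, hi⟩ := hne
  fin_cases i
  · exact fwd_ring P hht hp hi hIP hm hK
  · have := fwd_ring P hht hp1 hi (e1.le.trans hIP) hm hK.rot
    rw [← e1]; exact this
  · have := fwd_ring P hht hp2 hi (e2.le.trans hIP) hm hK.rot.rot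
    rw [← e2]; exact this

end Forward

section Final

variable {k : Type} [Field k]

lemma max_two_gen (P : Ideal (MvPolynomial (Fin 4) k)) [hP : P.IsPrime] (hht : P.height = 2) :
    ∃ x y, IsLocalRing.maximalIdeal (Localization.AtPrime P) = Ideal.span {x, y} := by
  have : IsRegularRing (MvPolynomial (Fin 4) k) := inferInstance
  have hreg : IsRegularLocalRing (Localization.AtPrime P) := inferInstance
  have h1 := IsRegularLocalRing.spanFinrank_maximalIdeal (R := Localization.AtPrime P)
  rw [IsLocalization.AtPrime.ringKrullDim_eq_height P, hht] at h1
  have h2 : Submodule.spanFinrank (IsLocalRing.maximalIdeal (Localization.AtPrime P)) = 2 := by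
    exact_mod_cast h1
  have hfg : (IsLocalRing.maximalIdeal (Localization.AtPrime P)).FG :=
    IsNoetherian.noetherian _
  obtain ⟨s, hs, hs'⟩ := Submodule.FG.exists_span_set_encard_eq_spanFinrank hfg
  rw [h2] at hs
  obtain ⟨x, y, -, rfl⟩ := Set.encard_eq_two.1 hs
  exact ⟨x, y, hs'.symm⟩

lemma sum_pieces {g : Fin 3 → MvPolynomial (Fin 4) k} (d : Fin 3 → ℤ × ℤ) :
    ∃ S : Finset (ℤ × ℤ), g = ∑ m ∈ S, fun i => weightedHomogeneousComponent bw (m - d i) (g i) := by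
  classical
  refine ⟨Finset.univ.biUnion fun i => (g i).support.image fun μ => Finsupp.weight bw μ + d i, ?_⟩
  ext1 i
  ext μ
  rw [Finset.sum_apply, coeff_sum]
  simp only [coeff_weightedHomogeneousComponent, eq_sub_iff_add_eq]
  rw [Finset.sum_ite_eq]
  split_ifs with h
  · rfl
  · by_contra hc
    apply h
    rw [Finset.mem_biUnion]
    exact ⟨i, Finset.mem_univ _, Finset.mem_image.2 ⟨μ, mem_support_iff.2 hc, rfl⟩⟩

lemma graded_locK {f : Fin 3 → MvPolynomial (Fin 4) k} {d : Fin 3 → ℤ × ℤ}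
    (hf : ∀ i, IsWeightedHomogeneous bw (f i) (d i))
    (H : ∀ (m : ℤ × ℤ) (g : Fin 3 → MvPolynomial (Fin 4) k),
      0 ≤ (m - d 0 - d 1 - d 2).1 → 0 ≤ (m - d 0 - d 1 - d 2).2 →
      (∀ i, IsWeightedHomogeneous bw (g i) (m - d i)) →
      (∀ i, g i ∈ Ideal.span {f 0, f 1, f 2}) →
      g 0 * f 0 + g 1 * f 1 + g 2 * f 2 = 0 → ∃ c, g = dK f c)
    {P : Ideal (MvPolynomial (Fin 4) k)} [hP : P.IsPrime] (hirr : ¬ irrel k ≤ P) : LocK P f := by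
  obtain ⟨i, hi, j, hj, hij⟩ := irrel_not_le hirr
  intro g hg hs
  set x : MvPolynomial (Fin 4) k := X i * X j with hx
  have hxd : IsWeightedHomogeneous bw x (1, 1) := by
    refine hom_congr ((isWeightedHomogeneous_X k bw i).mul (isWeightedHomogeneous_X k bw j)) ?_
    rcases hi with rfl | rfl <;> rcases hj with rfl | rfl <;> simp [bw]
  suffices h : ∃ n : ℕ, ∃ c, x ^ n • g = dK f c by
    obtain ⟨n, hc⟩ := h
    exact ⟨x ^ n, fun h => hij (hP.mem_of_pow_mem _ h), hc⟩
  obtain ⟨S, hS⟩ := sum_pieces (g := g) d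
  rw [hS]
  refine Finset.sum_induction _ (fun g => ∃ n : ℕ, ∃ c, x ^ n • g = dK f c) ?_ ?_ ?_
  · rintro g g' ⟨n, c, hc⟩ ⟨n', c', hc'⟩
    refine ⟨n + n', x ^ n' • c + x ^ n • c', ?_⟩
    rw [map_add, map_smul, map_smul, ← hc, ← hc', smul_add, smul_smul, smul_smul, ← pow_add,
      ← pow_add, add_comm n' n]
  · exact ⟨0, 0, by simp⟩
  · intro m _
    set n : ℕ := (m - d 0 - d 1 - d 2).1.natAbs + (m - d 0 - d 1 - d 2).2.natAbs with hn
    have e1 : ∀ l : Fin 3, (((n : ℤ), (n : ℤ)) + m : ℤ × ℤ) - d l =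
        n • ((1, 1) : ℤ × ℤ) + (m - d l) := by
      intro l; ext <;> simp <;> ring
    refine ⟨n, H (((n : ℤ), (n : ℤ)) + m) _ ?_ ?_ ?_ ?_ ?_⟩
    · simp at hn ⊢; omega
    · simp at hn ⊢; omega
    · intro l
      rw [e1]
      exact (hxd.pow n).mul (comp_hom bw _ _)
    · intro l
      exact Ideal.mul_mem_left _ _ (HomI.span hf _ (hg l) _)
    · have h1 := congrArg (weightedHomogeneousComponent bw m) hs
      simp only [map_add, map_zero, comp_mul bw (hf _)] at h1
      simp only [Pi.smul_apply, smul_eq_mul]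
      linear_combination x ^ n * h1

end Final

theorem koszul_pieces_eq_vanishing_pieces_iff_lci
    (k : Type) [Field k]
    (f : Fin 3 → MvPolynomial (Fin 4) k) (d d' : Fin 3 → ℤ)
    (hf : ∀ i, Bihom (f i) (d i) (d' i))
    (I : Ideal (MvPolynomial (Fin 4) k)) (hI : I = Ideal.span {f 0, f 1, f 2})
    (hht : idealHeight I = 2)
    -- no minimal prime over I contains the irrelevant ideal:
    (hirr : ∀ P ∈ I.minimalPrimes, ¬ (irrel k ≤ P)) :
    (∀ a b : ℤ,
      (a - d 0 - d 1 - d 2 + 1) * (b - d' 0 - d' 1 - d' 2 + 1) ≥ 0 →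
      { g : Fin 3 → MvPolynomial (Fin 4) k |
          g ∈ Kos (f 0) (f 1) (f 2) ∧ ∀ i, Bihom (g i) (a - d i) (b - d' i) } =
      { g : Fin 3 → MvPolynomial (Fin 4) k |
          (g 0 * f 0 + g 1 * f 1 + g 2 * f 2 = 0 ∧ ∀ i, g i ∈ Ideal.sat (irrel k) I) ∧
          ∀ i, Bihom (g i) (a - d i) (b - d' i) })
    ↔
    (∀ (P : Ideal (MvPolynomial (Fin 4) k)) (hP : P ∈ I.minimalPrimes),
      letI : P.IsPrime := hP.1.1
      ∃ x y : Localization.AtPrime P,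
        I.map (algebraMap (MvPolynomial (Fin 4) k) (Localization.AtPrime P)) =
          Ideal.span {x, y} ∧
        RingTheory.Sequence.IsRegular (Localization.AtPrime P) [x, y]) := by
  subst hI
  have hf' : ∀ i, IsWeightedHomogeneous bw (f i) ((fun i => (d i, d' i)) i) := hf
  constructor
  · intro H P hP
    have hPp : P.IsPrime := hP.1.1
    have h1 : HomI bw₁ (Ideal.span {f 0, f 1, f 2}) := HomI.span fun i => hom_bw₁ (hf' i)
    have h2 : HomI bw₂ (Ideal.span {f 0, f 1, f 2}) := HomI.span fun i => hom_bw₂ (hf' i)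
    have hle := height_le_two' (h1.minimalPrime hP) (h2.minimalPrime hP) (hirr P hP)
    have hge := two_le_height hht hP.1.2
    obtain ⟨x, y, hxy⟩ := max_two_gen P (le_antisymm hle hge)
    refine fwd_ring' P hle (not_dvd_all hht) (exists_ne_zero hht) hP.1.2 hxy ?_
    refine graded_locK hf' ?_ (hirr P hP)
    intro m g hm1 hm2 hg hgI hs
    simp at hm1 hm2
    have hset := H m.1 m.2 (mul_nonneg (by linarith) (by linarith))
    have hmem := (Set.ext_iff.1 hset g).2
      ⟨⟨hs, fun i => ⟨0, fun y _ => Ideal.mul_mem_left _ _ (hgI i)⟩⟩, hg⟩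
    exact (mem_Kos_iff f g).1 hmem.1
  · intro H a b hab
    ext g
    constructor
    · rintro ⟨hg, hgd⟩
      obtain ⟨c, rfl⟩ := (mem_Kos_iff f g).1 hg
      exact ⟨⟨kos_syz f c, fun i => ⟨0, fun y _ => Ideal.mul_mem_left _ _ (kos_mem f c i)⟩⟩, hgd⟩
    · rintro ⟨⟨hs, hsat⟩, hgd⟩
      refine ⟨(mem_Kos_iff f g).2 ?_, hgd⟩
      refine main_bwd hf' hht (m := (a, b)) hgd hab hs ?_
      intro P hP
      have hPp : P.IsPrime := hP.1.1
      obtain ⟨x, y, hxy, hreg⟩ := H P hP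
      obtain ⟨r, hr, hrg⟩ := exists_common_pow (hirr P hP) hsat
      exact loc_bwd P hxy hreg hr hrg hs

end
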